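/- arXiv:1603.05430 — 2 statements merged into one kernel-verified Lean document; each statement's English description precedes it below -/
import Mathlib

section
/- For every d ≥ 2, the Pythagoras number of ternary forms of degree 2d satisfies d + 1 ≤ p(3,2d) ≤ d + 2. That is: every sum of squares of degree-d forms in ℝ[x_1,x_2,x_3] is a sum of at most d+2 such squares, and there exists one that is not a sum of d squares. -/
noncomputable section

section LowerBound

open MvPolynomial

/-- `f` is a sum of `r` squares of forms of degree `d` in `n` variables. -/
def IsSOS (n d r : ℕ) (f : MvPolynomial (Fin n) ℝ) : Prop :=
  ∃ p : Fin r → MvPolynomial (Fin n) ℝ,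
    (∀ i, (p i).IsHomogeneous d) ∧ f = ∑ i, p i ^ 2

/-- `f` lies in `Σ_{n,2d}`: it is a sum of squares of forms of degree `d`. -/
def InSigma (n d : ℕ) (f : MvPolynomial (Fin n) ℝ) : Prop :=
  ∃ r, IsSOS n d r f

/-- The sum of squares length `ℓ(f)`. -/
def sosLength (n d : ℕ) (f : MvPolynomial (Fin n) ℝ) : ℕ :=
  sInf {r | IsSOS n d r f}

/-! ### Lower bound -/

/-- Product of `X - j` over the nodes `j ≠ i` in `0, …, d`. -/
def nodePoly (d : ℕ) (i : Fin (d + 1)) : Polynomial ℝ :=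
  ∏ j ∈ Finset.univ.erase i, (Polynomial.X - Polynomial.C ((j : ℕ) : ℝ))

/-- Product of the lines `x₁ - j x₀ + j² x₂` over `j ≠ i`. -/
def lineForm (d : ℕ) (i : Fin (d + 1)) : MvPolynomial (Fin 3) ℝ :=
  ∏ j ∈ Finset.univ.erase i,
    (X 1 - C ((j : ℕ) : ℝ) * X 0 + C (((j : ℕ) : ℝ) ^ 2) * X 2)

lemma lineForm_homog (d : ℕ) (i : Fin (d + 1)) : (lineForm d i).IsHomogeneous d := by
  have h := IsHomogeneous.prod (Finset.univ.erase i)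
    (fun j : Fin (d + 1) => (X 1 - C ((j : ℕ) : ℝ) * X 0 + C (((j : ℕ) : ℝ) ^ 2) * X 2 :
      MvPolynomial (Fin 3) ℝ)) (fun _ => 1) (fun j _ => by
      have h1 : ∀ (c : ℝ) (k : Fin 3), (C c * X k : MvPolynomial (Fin 3) ℝ).IsHomogeneous 1 := by
        intro c k
        simpa using (isHomogeneous_C (Fin 3) c).mul (isHomogeneous_X ℝ k)
      exact ((isHomogeneous_X ℝ 1).sub (h1 _ _)).add (h1 _ _))
  simpa [lineForm] using h

lemma lineForm_eval (d : ℕ) (i : Fin (d + 1)) (u v : ℝ) :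
    eval ![u + v, u * v, 1] (lineForm d i) = (nodePoly d i).eval u * (nodePoly d i).eval v := by
  simp only [lineForm, nodePoly, map_prod, Polynomial.eval_prod, ← Finset.prod_mul_distrib]
  refine Finset.prod_congr rfl fun j _ => ?_
  simp
  ring

lemma nodePoly_eval_ne (d : ℕ) {i j : Fin (d + 1)} (h : i ≠ j) :
    (nodePoly d i).eval ((j : ℕ) : ℝ) = 0 := by
  rw [nodePoly, Polynomial.eval_prod]
  exact Finset.prod_eq_zero (i := j) (by simp [h.symm]) (by simp)

lemma nodePoly_eval_self (d : ℕ) (i : Fin (d + 1)) :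
    (nodePoly d i).eval ((i : ℕ) : ℝ) ≠ 0 := by
  rw [nodePoly, Polynomial.eval_prod]
  refine Finset.prod_ne_zero_iff.2 fun j hj => ?_
  simp only [Finset.mem_erase] at hj
  simp only [Polynomial.eval_sub, Polynomial.eval_X, Polynomial.eval_C, ne_eq, sub_eq_zero,
    Nat.cast_inj]
  exact fun h => hj.1 (Fin.ext h.symm)

lemma nodePoly_natDegree (d : ℕ) (i : Fin (d + 1)) : (nodePoly d i).natDegree = d := by
  rw [nodePoly, Polynomial.natDegree_prod_of_monic _ _ (fun j _ => Polynomial.monic_X_sub_C _)]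
  simp only [Polynomial.natDegree_X_sub_C]
  simp

lemma nodePoly_ne_zero (d : ℕ) (i : Fin (d + 1)) : nodePoly d i ≠ 0 :=
  fun h => nodePoly_eval_self d i (by simp [h])

lemma nodePoly_deriv (d : ℕ) {i j : Fin (d + 1)} (h : i ≠ j) :
    (nodePoly d i).derivative.eval ((j : ℕ) : ℝ) ≠ 0 := by
  have hj : j ∈ Finset.univ.erase i := by simp [h.symm]
  rw [nodePoly, ← Finset.mul_prod_erase _ _ hj]
  simp only [Polynomial.derivative_mul, Polynomial.derivative_sub, Polynomial.derivative_X,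
    Polynomial.derivative_C, sub_zero, one_mul, Polynomial.eval_add, Polynomial.eval_mul,
    Polynomial.eval_sub, Polynomial.eval_X, Polynomial.eval_C, sub_self, zero_mul, add_zero]
  rw [Polynomial.eval_prod]
  refine Finset.prod_ne_zero_iff.2 fun k hk => ?_
  simp only [Finset.mem_erase] at hk
  simp only [Polynomial.eval_sub, Polynomial.eval_X, Polynomial.eval_C, ne_eq, sub_eq_zero,
    Nat.cast_inj]
  exact fun h => hk.1 (Fin.ext h.symm)

lemma node_interp (d : ℕ) (Q : Polynomial ℝ) (hQ : Q.natDegree ≤ d) (u : ℝ) :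
    Q.eval u = ∑ a : Fin (d + 1), Q.eval ((a : ℕ) : ℝ) /
      (nodePoly d a).eval ((a : ℕ) : ℝ) * (nodePoly d a).eval u := by
  have key : Q = ∑ a : Fin (d + 1), Polynomial.C (Q.eval ((a : ℕ) : ℝ) /
      (nodePoly d a).eval ((a : ℕ) : ℝ)) * nodePoly d a := by
    refine Polynomial.eq_of_degrees_lt_of_eval_index_eq (s := Finset.univ)
      (v := fun a : Fin (d + 1) => ((a : ℕ) : ℝ)) ?_ ?_ ?_ ?_
    · intro a _ b _ h
      exact Fin.ext (by simpa using h)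
    · simp only [Finset.card_univ, Fintype.card_fin]
      exact lt_of_le_of_lt Polynomial.degree_le_natDegree (by exact_mod_cast Nat.lt_succ_of_le hQ)
    · simp only [Finset.card_univ, Fintype.card_fin]
      refine lt_of_le_of_lt Polynomial.degree_le_natDegree ?_
      have : (∑ a : Fin (d + 1), Polynomial.C (Q.eval ((a : ℕ) : ℝ) /
        (nodePoly d a).eval ((a : ℕ) : ℝ)) * nodePoly d a).natDegree ≤ d := by
        refine Polynomial.natDegree_sum_le_of_forall_le _ _ fun a _ => ?_
        exact (Polynomial.natDegree_C_mul_le _ _).trans (nodePoly_natDegree d a).le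
      exact_mod_cast Nat.lt_succ_of_le this
    · intro b _
      rw [Polynomial.eval_finsetSum, Finset.sum_eq_single b]
      · simp [nodePoly_eval_self]
      · intro a _ h
        simp [nodePoly_eval_ne d h]
      · simp
  conv_lhs => rw [key]
  simp [Polynomial.eval_finsetSum]

lemma form_restrict (d : ℕ) (q : MvPolynomial (Fin 3) ℝ) (hq : q.IsHomogeneous d) (v : ℝ) :
    ∃ Q : Polynomial ℝ, Q.natDegree ≤ d ∧ ∀ u, Q.eval u = eval ![u + v, u * v, 1] q := by
  refine ⟨aeval ![Polynomial.X + Polynomial.C v, Polynomial.X * Polynomial.C v, 1] q, ?_, ?_⟩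
  · rw [aeval_def, eval₂_eq']
    refine Polynomial.natDegree_sum_le_of_forall_le _ _ fun m hm => ?_
    have hm' : m 0 + (m 1 + m 2) = d := by
      have := hq (mem_support_iff.1 hm)
      simpa [Finsupp.weight_apply, Finsupp.sum_fintype, Fin.sum_univ_three, add_assoc] using this
    rw [Fin.prod_univ_three]
    refine (Polynomial.natDegree_C_mul_le _ _).trans ?_
    refine Polynomial.natDegree_mul_le_of_le (m := m 0 + m 1) (n := 0)
      (Polynomial.natDegree_mul_le_of_le ?_ ?_) ?_ |>.trans (by omega)
    · refine Polynomial.natDegree_pow_le_of_le (m 0) (m := 1) ?_ |>.trans (by simp)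
      simp
    · refine Polynomial.natDegree_pow_le_of_le (m 1) (m := 1) ?_ |>.trans (by simp)
      simpa using Polynomial.natDegree_mul_C_le Polynomial.X v
    · simp
  · intro u
    have : (Polynomial.evalRingHom u).comp (aeval (R := ℝ) ![Polynomial.X + Polynomial.C v,
        Polynomial.X * Polynomial.C v, 1]).toRingHom = eval ![u + v, u * v, 1] := by
      apply MvPolynomial.ringHom_ext
      · intro r; simp
      · intro i; fin_cases i <;> simp <;> ring
    exact congrArg (fun φ => φ q) this

lemma not_sos (d : ℕ) : ¬ IsSOS 3 d d (∑ i, lineForm d i ^ 2) := by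
  rintro ⟨q, hq, hf⟩
  set N : Fin (d + 1) → ℝ := fun a => ((a : ℕ) : ℝ) with hN
  set Q : Fin d → ℝ → ℝ → ℝ := fun k u v => eval ![u + v, u * v, 1] (q k) with hQ
  have hsum : ∀ u v, ∑ k, Q k u v ^ 2 =
      ∑ a, ((nodePoly d a).eval u * (nodePoly d a).eval v) ^ 2 := by
    intro u v
    have := congrArg (eval ![u + v, u * v, 1]) hf
    simp only [map_sum, map_pow, lineForm_eval] at this
    exact this.symm
  have hsymm : ∀ k u v, Q k u v = Q k v u := by
    intro k u v
    simp only [hQ, add_comm u v, mul_comm u v]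
  have hoff : ∀ k a b, a ≠ b → Q k (N a) (N b) = 0 := by
    intro k a b hab
    have h := hsum (N a) (N b)
    rw [Finset.sum_eq_zero (s := Finset.univ) (f := fun c => ((nodePoly d c).eval (N a) *
      (nodePoly d c).eval (N b)) ^ 2)] at h
    · rw [Finset.sum_eq_zero_iff_of_nonneg (fun _ _ => sq_nonneg _)] at h
      exact pow_eq_zero_iff (two_ne_zero) |>.1 (h k (Finset.mem_univ _))
    · intro c _
      by_cases hc : c = a
      · subst hc; simp [hN, nodePoly_eval_ne d hab]
      · simp [hN, nodePoly_eval_ne d hc]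
  set c : Fin d → Fin (d + 1) → ℝ := fun k a =>
    Q k (N a) (N a) / (nodePoly d a).eval (N a) ^ 2 with hc
  have hQc : ∀ k u v, Q k u v = ∑ a, c k a * ((nodePoly d a).eval u * (nodePoly d a).eval v) := by
    intro k u v
    obtain ⟨R, hR, hRe⟩ := form_restrict d (q k) (hq k) v
    rw [show Q k u v = R.eval u from (hRe u).symm, node_interp d R hR u]
    refine Finset.sum_congr rfl fun a _ => ?_
    obtain ⟨S, hS, hSe⟩ := form_restrict d (q k) (hq k) (N a)
    have : R.eval (N a) = Q k (N a) (N a) / (nodePoly d a).eval (N a) * (nodePoly d a).eval v := by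
      rw [hRe, show eval ![N a + v, N a * v, 1] (q k) = Q k (N a) v from rfl, hsymm,
        show Q k v (N a) = S.eval v from (hSe v).symm, node_interp d S hS v,
        Finset.sum_eq_single a]
      · rw [hSe]
      · intro b _ hb
        rw [hSe, show eval ![(b : ℕ) + N a, (b : ℕ) * N a, 1] (q k) = Q k (N b) (N a) from rfl,
          hoff k b a hb]
        simp
      · simp
    rw [this, hc]
    simp only [hN]
    field_simp
  have hG : ∀ a b, ∑ k, c k a * c k b = if a = b then 1 else 0 := by
    have hdiag : ∀ a, ∑ k, c k a * c k a = 1 := by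
      intro a
      have h := hsum (N a) (N a)
      rw [Finset.sum_eq_single a (by
        intro b _ hb
        simp [hN, nodePoly_eval_ne d hb]) (by simp)] at h
      have h0 : (nodePoly d a).eval (N a) ≠ 0 := nodePoly_eval_self d a
      have : ∑ k, c k a * c k a = (∑ k, Q k (N a) (N a) ^ 2) / (nodePoly d a).eval (N a) ^ 4 := by
        rw [Finset.sum_div]
        refine Finset.sum_congr rfl fun k _ => ?_
        simp only [hc]
        field_simp
      rw [this, h]
      field_simp
    set G : Fin (d + 1) → Fin (d + 1) → ℝ := fun a b => ∑ k, c k a * c k b with hGdef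
    have hpoly : ∀ v, ∑ a, ∑ b, Polynomial.C (G a b * ((nodePoly d a).eval v *
        (nodePoly d b).eval v)) * (nodePoly d a * nodePoly d b) =
        ∑ a, Polynomial.C ((nodePoly d a).eval v ^ 2) * (nodePoly d a * nodePoly d a) := by
      intro v
      refine Polynomial.funext fun u => ?_
      simp only [Polynomial.eval_finsetSum, Polynomial.eval_mul, Polynomial.eval_C]
      have h := hsum u v
      calc _ = ∑ k, Q k u v ^ 2 := by
            simp only [hQc, sq, Finset.sum_mul_sum, hGdef]
            rw [Finset.sum_comm]
            rw [Finset.sum_comm (s := (Finset.univ : Finset (Fin d)))]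
            rw [Finset.sum_comm]
            refine Finset.sum_congr rfl fun a _ => ?_
            rw [Finset.sum_comm]
            refine Finset.sum_congr rfl fun b _ => ?_
            rw [Finset.sum_mul, Finset.sum_mul]
            refine Finset.sum_congr rfl fun k _ => ?_
            ring
        _ = _ := h
        _ = _ := Finset.sum_congr rfl fun a _ => by ring
    intro i j
    by_cases hij : i = j
    · subst hij; simpa using hdiag i
    rw [if_neg hij]
    have hder : ∀ v, (nodePoly d i).eval v * ∑ a, (if a = i then 0 else
        G a i * (nodePoly d a).derivative.eval (N i) * (nodePoly d a).eval v) = 0 := by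
      intro v
      have h := congrArg (fun p => (Polynomial.derivative p).eval (N i)) (hpoly v)
      simp only [Polynomial.derivative_sum, Polynomial.eval_finsetSum, Polynomial.derivative_mul,
        Polynomial.derivative_C, Polynomial.eval_mul, Polynomial.eval_add, Polynomial.eval_C,
        zero_mul, zero_add] at h
      have hz : ∀ a, a ≠ i → (nodePoly d a).eval (N i) = 0 := fun a ha => nodePoly_eval_ne d ha
      set e := (nodePoly d i).eval (N i) with he
      have he0 : e ≠ 0 := nodePoly_eval_self d i
      have hE : ∀ a, (nodePoly d a).eval (N i) = if a = i then e else 0 := by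
        intro a
        split_ifs with ha
        · rw [ha]
        · exact hz a ha
      have hsG : ∀ a b, G a b = G b a := fun a b =>
        Finset.sum_congr rfl fun k _ => mul_comm _ _
      have hii : G i i = 1 := hdiag i
      simp only [hE, mul_add, Finset.sum_add_distrib, mul_ite, ite_mul, mul_zero, zero_mul,
        Finset.sum_ite_eq', Finset.mem_univ, if_true] at h
      rw [Finset.sum_comm (f := fun a b => if a = i then _ else 0)] at h
      simp only [Finset.sum_ite_eq', Finset.mem_univ, if_true] at h
      set T := ∑ a, G a i * (nodePoly d a).derivative.eval (N i) * (nodePoly d a).eval v with hT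
      have h1 : ∑ a, G a i * (Polynomial.eval v (nodePoly d a) * Polynomial.eval v (nodePoly d i)) *
          (Polynomial.eval (N i) (Polynomial.derivative (nodePoly d a)) * e) =
          T * (Polynomial.eval v (nodePoly d i) * e) := by
        rw [hT, Finset.sum_mul]
        exact Finset.sum_congr rfl fun a _ => by ring
      have h2 : ∑ a, G i a * (Polynomial.eval v (nodePoly d i) * Polynomial.eval v (nodePoly d a)) *
          (e * Polynomial.eval (N i) (Polynomial.derivative (nodePoly d a))) =
          T * (Polynomial.eval v (nodePoly d i) * e) := by
        rw [hT, Finset.sum_mul]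
        exact Finset.sum_congr rfl fun a _ => by rw [hsG i a]; ring
      rw [h1, h2] at h
      have h3 : ∑ a, (if a = i then 0 else
          G a i * (nodePoly d a).derivative.eval (N i) * (nodePoly d a).eval v) =
          T - (nodePoly d i).derivative.eval (N i) * (nodePoly d i).eval v := by
        rw [hT, ← Finset.add_sum_erase _ _ (Finset.mem_univ i),
          ← Finset.add_sum_erase (a := i) Finset.univ (fun a => G a i * _ * _) (Finset.mem_univ i),
          hii]
        simp only [if_true]
        rw [Finset.sum_congr rfl (g := fun a => G a i * (nodePoly d a).derivative.eval (N i) *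
          (nodePoly d a).eval v) (fun a ha => if_neg (Finset.ne_of_mem_erase ha))]
        ring
      rw [h3]
      have : 2 * e ≠ 0 := by simpa using he0
      apply mul_left_cancel₀ this
      linear_combination h
    have hprod : nodePoly d i * ∑ a, (if a = i then 0 else Polynomial.C
        (G a i * (nodePoly d a).derivative.eval (N i)) * (nodePoly d a)) = 0 := by
      refine Polynomial.funext fun v => ?_
      rw [Polynomial.eval_mul, Polynomial.eval_finsetSum, Polynomial.eval_zero, ← hder v]
      congr 1
      refine Finset.sum_congr rfl fun a _ => ?_
      split_ifs <;> simp
    have h2 := (mul_eq_zero.1 hprod).resolve_left (nodePoly_ne_zero d i)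
    have h3 := congrArg (Polynomial.eval (N j)) h2
    rw [Polynomial.eval_finsetSum, Finset.sum_eq_single j (by
      intro b _ hb
      split_ifs <;> simp [hN, nodePoly_eval_ne d hb]) (by simp), if_neg (Ne.symm hij)] at h3
    simp only [Polynomial.eval_mul, Polynomial.eval_C, Polynomial.eval_zero, mul_eq_zero] at h3
    rcases h3 with (h3 | h3) | h3
    · rw [← h3]; exact Finset.sum_congr rfl fun k _ => mul_comm _ _
    · exact absurd h3 (nodePoly_deriv d (Ne.symm hij))
    · exact absurd h3 (nodePoly_eval_self d j)
  have hm : (Matrix.of c).transpose * Matrix.of c = 1 := by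
    ext a b
    simp [Matrix.mul_apply, Matrix.one_apply, hG]
  have h1 := Matrix.rank_mul_le_right (Matrix.of c).transpose (Matrix.of c)
  rw [hm, Matrix.rank_one] at h1
  have h2 := Matrix.rank_le_card_height (Matrix.of c)
  simp at h1 h2
  omega

end LowerBound

section PolyMat

open Polynomial Matrix

/-- A real polynomial that is nonnegative everywhere. -/
def PolyNonneg (p : ℝ[X]) : Prop := ∀ t, 0 ≤ p.eval t

/-- A symmetric positive semidefinite polynomial matrix. -/
def PolyPSD {ι : Type} [Fintype ι] (M : Matrix ι ι ℝ[X]) : Prop :=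
  M.IsSymm ∧ ∀ v : ι → ℝ[X], PolyNonneg (v ⬝ᵥ M *ᵥ v)

lemma polyNonneg_cancel {p q : ℝ[X]} (hq : PolyNonneg q) (hq0 : q ≠ 0) (h : PolyNonneg (q * p)) :
    PolyNonneg p := by
  have hcl : IsClosed {t : ℝ | 0 ≤ p.eval t} := isClosed_le continuous_const p.continuous
  have hd : Dense ({t : ℝ | q.eval t = 0}ᶜ) := by
    apply Set.Countable.dense_compl ℝ
    apply Set.Finite.countable
    exact (q.rootSet_finite ℝ).subset (fun t ht => by
      simpa [Polynomial.mem_rootSet, hq0] using ht)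
  have hsub : {t : ℝ | q.eval t = 0}ᶜ ⊆ {t : ℝ | 0 ≤ p.eval t} := by
    intro t ht
    have h1 := h t
    have h2 : 0 < q.eval t := lt_of_le_of_ne (hq t) (Ne.symm ht)
    rw [Polynomial.eval_mul] at h1
    exact nonneg_of_mul_nonneg_right h1 h2
  have : {t : ℝ | 0 ≤ p.eval t} = Set.univ := by
    rw [← hcl.closure_eq]
    exact (hd.mono hsub).closure_eq
  intro t
  have ht : t ∈ {t : ℝ | 0 ≤ p.eval t} := by rw [this]; trivial
  exact ht

lemma polyNonneg_sq (p : ℝ[X]) : PolyNonneg (p ^ 2) := fun t => by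
  rw [Polynomial.eval_pow]; positivity

lemma PolyPSD.congr {ι : Type} [Fintype ι] {M : Matrix ι ι ℝ[X]} (hM : PolyPSD M) (E : Matrix ι ι ℝ[X]) :
    PolyPSD (Eᵀ * M * E) := by
  refine ⟨?_, fun v => ?_⟩
  · have := hM.1
    unfold Matrix.IsSymm at *
    simp [Matrix.transpose_mul, this, Matrix.mul_assoc]
  · have : v ⬝ᵥ (Eᵀ * M * E) *ᵥ v = (E *ᵥ v) ⬝ᵥ M *ᵥ (E *ᵥ v) := by
      rw [← Matrix.mulVec_mulVec, ← Matrix.mulVec_mulVec, Matrix.dotProduct_mulVec,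
        Matrix.vecMul_transpose]
    rw [this]
    exact hM.2 _

variable {ι : Type} [Fintype ι] [DecidableEq ι]

lemma det_colMat (i : ι) (v : ι → ℝ[X]) :
    ((1 : Matrix ι ι ℝ[X]).updateCol i v).det = v i := by
  have := Matrix.cramer_apply (1 : Matrix ι ι ℝ[X]) v i
  rw [Matrix.cramer_one] at this
  simpa using this.symm

lemma colMat_mulVec (i : ι) (v : ι → ℝ[X]) :
    ((1 : Matrix ι ι ℝ[X]).updateCol i v) *ᵥ Pi.single i 1 = v := by
  ext1 j
  simp

lemma congr_entry (E M : Matrix ι ι ℝ[X]) (j k : ι) :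
    (Eᵀ * M * E) j k = (E *ᵥ Pi.single j 1) ⬝ᵥ M *ᵥ (E *ᵥ Pi.single k 1) := by
  rw [Matrix.mulVec_mulVec, Matrix.dotProduct_mulVec, Matrix.mulVec_single_one,
    Matrix.mul_assoc, Matrix.mul_apply', ← Matrix.dotProduct_mulVec]
  congr 1
  ext l
  simp

lemma colMat_mulVec_ne (i j : ι) (h : j ≠ i) (v : ι → ℝ[X]) :
    ((1 : Matrix ι ι ℝ[X]).updateCol i v) *ᵥ Pi.single j 1 = Pi.single j 1 := by
  ext1 k
  simp [h, Matrix.one_apply, Pi.single_apply]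

/-- A unimodular change of coordinates. -/
lemma colMat_undo (M : Matrix ι ι ℝ[X]) (E : Matrix ι ι ℝ[X]) (hE : IsUnit E.det) :
    M = E⁻¹ᵀ * (Eᵀ * M * E) * E⁻¹ := by
  have h1 : E * E⁻¹ = 1 := Matrix.mul_nonsing_inv E hE
  calc M = (E * E⁻¹)ᵀ * M * (E * E⁻¹) := by rw [h1]; simp
    _ = _ := by rw [Matrix.transpose_mul]; simp only [Matrix.mul_assoc]

/-- Enlarging the lattice by `v / π`. -/
lemma lattice_step {M : Matrix ι ι ℝ[X]} (hM : PolyPSD M) {π : ℝ[X]} (hπ : π ≠ 0)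
    (v : ι → ℝ[X]) (i : ι) (hvi : v i = 1) (h1 : ∀ j, π ∣ (M *ᵥ v) j)
    (h2 : π ^ 2 ∣ v ⬝ᵥ M *ᵥ v) :
    ∃ C M' : Matrix ι ι ℝ[X], PolyPSD M' ∧ M = Cᵀ * M' * C ∧ M.det = π ^ 2 * M'.det := by
  set E := (1 : Matrix ι ι ℝ[X]).updateCol i v with hE
  have hdet : E.det = 1 := by rw [hE, det_colMat, hvi]
  set N := Eᵀ * M * E with hN
  have hNP : PolyPSD N := hM.congr E
  set D : ι → ℝ[X] := fun j => if j = i then π else 1 with hD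
  have hD0 : ∀ j, D j ≠ 0 := by
    intro j
    simp only [hD]
    split_ifs
    · exact hπ
    · exact one_ne_zero
  have hcol : ∀ j, π ∣ N j i := by
    intro j
    rw [hN, congr_entry, hE, colMat_mulVec]
    exact Finset.dvd_sum fun k _ => (h1 k).mul_left _
  have hdvd : ∀ j k, D j * D k ∣ N j k := by
    intro j k
    simp only [hD]
    split_ifs with hj hk hk
    · subst hj; subst hk
      rw [hN, congr_entry, hE, colMat_mulVec, ← sq]
      exact h2
    · subst hj
      rw [mul_one, ← hNP.1.apply]
      exact hcol k
    · subst hk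
      rw [one_mul]; exact hcol j
    · simp
  choose M' hM' using hdvd
  have hNM : N = diagonal D * (Matrix.of M') * diagonal D := by
    ext1 j k
    rw [Matrix.mul_diagonal, Matrix.diagonal_mul, hM' j k, Matrix.of_apply]
    ring
  refine ⟨diagonal D * E⁻¹, Matrix.of M', ⟨?_, ?_⟩, ?_, ?_⟩
  · refine Matrix.IsSymm.ext fun j k => ?_
    have h := hNP.1.apply j k
    rw [hM' j k, hM' k j, mul_comm (D k)] at h
    exact mul_left_cancel₀ (mul_ne_zero (hD0 j) (hD0 k)) h
  · intro w
    apply polyNonneg_cancel (polyNonneg_sq π) (pow_ne_zero 2 hπ)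
    obtain ⟨w', hw'⟩ : ∃ w' : ι → ℝ[X], w' = fun j => (if j = i then 1 else π) * w j := ⟨_, rfl⟩
    have h := hNP.2 w'
    convert h using 1
    have hw : diagonal D *ᵥ w' = π • w := by
      ext1 j
      rw [hw']
      rw [Matrix.mulVec_diagonal]
      simp only [hD, Pi.smul_apply, smul_eq_mul]
      split_ifs <;> ring
    rw [hNM, ← Matrix.mulVec_mulVec, ← Matrix.mulVec_mulVec, Matrix.dotProduct_mulVec w',
      ← Matrix.mulVec_transpose, Matrix.diagonal_transpose, hw, Matrix.mulVec_smul,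
      smul_dotProduct, dotProduct_smul]
    simp only [smul_eq_mul]
    ring
  · have := colMat_undo M E (by rw [hdet]; exact isUnit_one)
    rw [this, ← hN, hNM, Matrix.transpose_mul, Matrix.diagonal_transpose]
    simp only [Matrix.mul_assoc]
  · have h3 : N.det = M.det := by
      rw [hN, Matrix.det_mul, Matrix.det_mul, Matrix.det_transpose, hdet]; simp
    have h4 : ∏ j, D j = π := by
      simp [hD]
    rw [← h3, hNM, Matrix.det_mul, Matrix.det_mul, Matrix.det_diagonal, h4]
    ring

/-- A kernel vector modulo `π`. -/
lemma exists_kernel {F : Type} [Field F] (φ : ℝ[X] →+* F) (hφ : Function.Surjective φ)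
    (M : Matrix ι ι ℝ[X]) (h : φ M.det = 0) :
    ∃ (v : ι → ℝ[X]) (i : ι), v i = 1 ∧ ∀ j, φ ((M *ᵥ v) j) = 0 := by
  have hdet : (φ.mapMatrix M).det = 0 := by rw [← RingHom.map_det, h]
  obtain ⟨w, hw0, hw⟩ := Matrix.exists_mulVec_eq_zero_iff.2 hdet
  obtain ⟨i, hi⟩ := Function.ne_iff.1 hw0
  choose σ hσ using hφ
  have hi' : w i ≠ 0 := hi
  refine ⟨Function.update (fun j => σ (w j / w i)) i 1, i, by simp, fun j => ?_⟩
  have hv : ∀ k, φ (Function.update (fun j => σ (w j / w i)) i 1 k) = w k / w i := by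
    intro k
    by_cases hk : k = i
    · subst hk; simp [hi']
    · simp [hk, hσ]
  have h2 := congrFun hw j
  simp only [Matrix.mulVec, dotProduct, map_sum, map_mul, hv] at h2 ⊢
  simp only [RingHom.mapMatrix_apply, Matrix.map_apply, Pi.zero_apply] at h2
  simp only [← mul_div_assoc]
  rw [← Finset.sum_div, h2, zero_div]


lemma lift_reduce {M : Matrix ι ι ℝ[X]} {g π : ℝ[X]} (hg : g ≠ 0) (hdet : M.det = g ^ 2)
    (hπ0 : 0 < π.natDegree) (hπg : π ∣ g)
    (h : ∃ C M' : Matrix ι ι ℝ[X], PolyPSD M' ∧ M = Cᵀ * M' * C ∧ M.det = π ^ 2 * M'.det) :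
    ∃ (C M' : Matrix ι ι ℝ[X]) (g' : ℝ[X]), PolyPSD M' ∧ M = Cᵀ * M' * C ∧ M'.det = g' ^ 2 ∧
      g' ≠ 0 ∧ g'.natDegree < g.natDegree := by
  obtain ⟨C, M', h1, h2, h3⟩ := h
  obtain ⟨g', rfl⟩ := hπg
  have hπ : π ≠ 0 := left_ne_zero_of_mul hg
  have hg' : g' ≠ 0 := right_ne_zero_of_mul hg
  refine ⟨C, M', g', h1, h2, ?_, hg', ?_⟩
  · apply mul_left_cancel₀ (pow_ne_zero 2 hπ)
    rw [← h3, hdet]; ring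
  · rw [Polynomial.natDegree_mul hπ hg']; omega

lemma real_step {M : Matrix ι ι ℝ[X]} (hM : PolyPSD M) (a : ℝ) (h : M.det.eval a = 0) :
    ∃ C M' : Matrix ι ι ℝ[X], PolyPSD M' ∧ M = Cᵀ * M' * C ∧
      M.det = (X - Polynomial.C a) ^ 2 * M'.det := by
  obtain ⟨v, i, hv, hk⟩ := exists_kernel (evalRingHom a) (fun y => ⟨Polynomial.C y, by simp⟩) M
    (by simpa using h)
  have hd : ∀ j, (X - C a) ∣ (M *ᵥ v) j := fun j => by
    rw [Polynomial.dvd_iff_isRoot]; simpa using hk j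
  refine lattice_step hM (Polynomial.X_sub_C_ne_zero a) v i hv hd ?_
  have hp := hM.2 v
  have hd1 : (X - C a) ∣ v ⬝ᵥ M *ᵥ v := Finset.dvd_sum fun k _ => (hd k).mul_left _
  obtain ⟨r, hr⟩ := hd1
  have hmin : IsLocalMin (fun t => (v ⬝ᵥ M *ᵥ v).eval t) a := by
    refine Filter.Eventually.of_forall fun t => ?_
    have := hp t
    rw [hr] at this ⊢
    simpa using this
  have hder := hmin.deriv_eq_zero
  rw [Polynomial.deriv, hr] at hder
  simp [Polynomial.derivative_mul] at hder
  rw [hr, sq]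
  exact mul_dvd_mul_left _ (Polynomial.dvd_iff_isRoot.2 hder)

lemma complex_quadratic (a b c : ℂ) (ha : a ≠ 0) : ∃ s : ℂ, a * s ^ 2 + 2 * b * s + c = 0 := by
  obtain ⟨r, hr⟩ := IsAlgClosed.exists_pow_nat_eq (b ^ 2 - a * c) (n := 2) (by norm_num)
  refine ⟨(r - b) / a, ?_⟩
  field_simp
  linear_combination hr

lemma complex_step {M : Matrix ι ι ℝ[X]} (hM : PolyPSD M) {π : ℝ[X]} (hπ : π ≠ 0)
    (φ : ℝ[X] →+* ℂ) (hφ : Function.Surjective φ) (hker : ∀ p, φ p = 0 ↔ π ∣ p)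
    (h : π ^ 2 ∣ M.det) :
    ∃ C M' : Matrix ι ι ℝ[X], PolyPSD M' ∧ M = Cᵀ * M' * C ∧ M.det = π ^ 2 * M'.det := by
  obtain ⟨v, i, hv, hk⟩ := exists_kernel φ hφ M ((hker _).2 ((Dvd.intro_left _ (sq π).symm).trans h))
  have hd : ∀ j, π ∣ (M *ᵥ v) j := fun j => (hker _).1 (hk j)
  by_cases hiso : π ^ 2 ∣ v ⬝ᵥ M *ᵥ v
  · exact lattice_step hM hπ v i hv hd hiso
  set E := (1 : Matrix ι ι ℝ[X]).updateCol i v with hE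
  have hdet : E.det = 1 := by rw [hE, det_colMat, hv]
  set N := Eᵀ * M * E with hN
  have hNP : PolyPSD N := hM.congr E
  have hdetN : N.det = M.det := by
    rw [hN, Matrix.det_mul, Matrix.det_mul, Matrix.det_transpose, hdet]; simp
  suffices hs : ∃ C M' : Matrix ι ι ℝ[X], PolyPSD M' ∧ N = Cᵀ * M' * C ∧
      N.det = π ^ 2 * M'.det by
    obtain ⟨C, M', h1, h2, h3⟩ := hs
    refine ⟨C * E⁻¹, M', h1, ?_, by rw [← hdetN, h3]⟩
    have := colMat_undo M E (by rw [hdet]; exact isUnit_one)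
    rw [this, ← hN, h2, Matrix.transpose_mul]
    simp only [Matrix.mul_assoc]
  have hcol : ∀ j, π ∣ N j i := by
    intro j
    rw [hN, congr_entry, hE, colMat_mulVec]
    exact Finset.dvd_sum fun k _ => (hd k).mul_left _
  have hrow : ∀ k, π ∣ N i k := fun k => by rw [← hNP.1.apply]; exact hcol k
  choose n hn using hrow
  have hNii : N i i = v ⬝ᵥ M *ᵥ v := by rw [hN, congr_entry, hE, colMat_mulVec]
  have hni : φ (n i) ≠ 0 := by
    intro h0
    obtain ⟨m, hm⟩ := (hker _).1 h0
    exact hiso ⟨m, by rw [← hNii, hn, hm]; ring⟩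
  set N' := N.updateRow i n with hN'
  have hNN' : N = N.updateRow i (π • n) := by
    ext1 j k
    by_cases hj : j = i
    · subst hj; simp [hn k]
    · simp [hj]
  have hdN : N.det = π * N'.det := by
    conv_lhs => rw [hNN']
    rw [Matrix.det_updateRow_smul]
  have hdN' : φ N'.det = 0 := by
    rw [hker]
    rw [← hdetN, hdN, sq] at h
    exact (mul_dvd_mul_iff_left hπ).1 h
  have hdet' : (φ.mapMatrix N').det = 0 := by rw [← RingHom.map_det, hdN']
  obtain ⟨w, hw0, hw⟩ := Matrix.exists_mulVec_eq_zero_iff.2 hdet'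
  have hwj : ∀ j, ∑ k, φ (N' j k) * w k = 0 := fun j => congrFun hw j
  -- another coordinate of `w` is nonzero
  obtain ⟨i', hi', hwi'⟩ : ∃ i', i' ≠ i ∧ w i' ≠ 0 := by
    by_contra hcon
    push Not at hcon
    apply hw0
    have h1 := hwj i
    rw [Finset.sum_eq_single i (fun b _ hb => by rw [hcon b hb, mul_zero]) (by simp)] at h1
    have h2 : w i = 0 := by
      simp only [hN', Matrix.updateRow_self] at h1
      exact (mul_eq_zero.1 h1).resolve_left hni
    ext1 j
    by_cases hj : j = i
    · rw [hj, h2]; rfl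
    · exact hcon j hj
  choose σ hσ using hφ
  set x : ι → ℝ[X] := fun j => if j = i then 0 else if j = i' then 1 else σ (w j / w i') with hx
  have hφx : ∀ j, φ (x j) = if j = i then 0 else w j / w i' := by
    intro j
    simp only [hx]
    split_ifs with h1 h2
    · simp
    · subst h2; simp [hwi']
    · rw [hσ]
  have hNx : ∀ j, π ∣ (N *ᵥ x) j := by
    intro j
    by_cases hj : j = i
    · subst hj
      exact Finset.dvd_sum fun k _ => (Dvd.intro _ (hn k).symm).mul_right _
    · rw [← hker]
      simp only [Matrix.mulVec, dotProduct, map_sum, map_mul, hφx]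
      have h1 := hwj j
      have h2 : ∀ k, φ (N j k) * (if k = i then 0 else w k / w i') = φ (N' j k) * w k / w i' := by
        intro k
        have : N' j k = N j k := by simp [hN', hj]
        rw [this]
        split_ifs with hk
        · rw [hk, (hker _).2 (hcol j)]; simp
        · ring
      simp only [h2]
      rw [← Finset.sum_div, h1, zero_div]
  obtain ⟨β, hβ⟩ := hNx i
  obtain ⟨γ, hγ⟩ : π ∣ x ⬝ᵥ N *ᵥ x := Finset.dvd_sum fun k _ => (hNx k).mul_left _
  obtain ⟨s, hs⟩ := complex_quadratic (φ (n i)) (φ β) (φ γ) hni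
  set S := σ s with hS
  have hNe : ∀ j, (N *ᵥ Pi.single i 1) j = N j i := fun j => by simp
  refine lattice_step hNP hπ (x + S • Pi.single i 1) i' (by simp [hx, hi']) ?_ ?_
  · intro j
    rw [Matrix.mulVec_add, Matrix.mulVec_smul, Pi.add_apply, Pi.smul_apply, hNe, smul_eq_mul]
    exact dvd_add (hNx j) ((hcol j).mul_left _)
  · have hxe : x ⬝ᵥ N *ᵥ Pi.single i 1 = π * β := by
      rw [← hβ, Matrix.dotProduct_mulVec, ← Matrix.mulVec_transpose, hNP.1]
      simp
    have hex : Pi.single i 1 ⬝ᵥ N *ᵥ x = π * β := by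
      rw [← hβ]; simp
    have hee : Pi.single i 1 ⬝ᵥ N *ᵥ Pi.single i 1 = π * n i := by
      rw [← hn]; simp
    have : (x + S • Pi.single i 1) ⬝ᵥ N *ᵥ (x + S • Pi.single i 1) =
        π * (n i * S ^ 2 + 2 * β * S + γ) := by
      rw [Matrix.mulVec_add, Matrix.mulVec_smul, add_dotProduct, dotProduct_add, dotProduct_add,
        smul_dotProduct, smul_dotProduct, dotProduct_smul, dotProduct_smul, hxe, hex, hee, hγ]
      simp only [smul_eq_mul]
      ring
    rw [this, sq]
    apply mul_dvd_mul_left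
    rw [← hker]
    simp only [map_add, map_mul, map_pow, hS, hσ, map_ofNat]
    exact hs

/-- One step of the reduction of the determinant. -/
lemma det_reduce {M : Matrix ι ι ℝ[X]} (hM : PolyPSD M) {g : ℝ[X]} (hg : g ≠ 0)
    (hdet : M.det = g ^ 2) (hdeg : 0 < g.natDegree) :
    ∃ (C M' : Matrix ι ι ℝ[X]) (g' : ℝ[X]), PolyPSD M' ∧ M = Cᵀ * M' * C ∧ M'.det = g' ^ 2 ∧
      g' ≠ 0 ∧ g'.natDegree < g.natDegree := by
  obtain ⟨z, hz⟩ := IsAlgClosed.exists_aeval_eq_zero ℂ g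
    (Polynomial.natDegree_pos_iff_degree_pos.1 hdeg).ne'
  by_cases him : z.im = 0
  · have hza : z = ((z.re : ℝ) : ℂ) := Complex.ext rfl (by simp [him])
    have hroot : g.eval z.re = 0 := by
      rw [hza] at hz
      have h2 := Polynomial.aeval_algebraMap_apply ℂ z.re g
      rw [Complex.coe_algebraMap, hz] at h2
      simpa using h2.symm
    refine lift_reduce hg hdet (π := X - C z.re) (by simp)
      (Polynomial.dvd_iff_isRoot.2 hroot) (real_step hM z.re ?_)
    simp [hdet, hroot]
  · have hint : IsIntegral ℝ z := Algebra.IsIntegral.isIntegral z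
    have hdvd := minpoly.dvd ℝ z hz
    refine lift_reduce hg hdet (π := minpoly ℝ z) (minpoly.natDegree_pos hint) hdvd
      (complex_step hM (minpoly.ne_zero hint) (aeval z).toRingHom ?_ ?_ ?_)
    · intro w
      refine ⟨C (w.re - w.im / z.im * z.re) + C (w.im / z.im) * X, ?_⟩
      simp only [AlgHom.toRingHom_eq_coe, RingHom.coe_coe, map_add, map_mul, aeval_C, aeval_X]
      apply Complex.ext
      · simp
      · simp [him]
    · intro p
      exact (minpoly.dvd_iff).symm
    · rw [hdet]; exact pow_dvd_pow_of_dvd hdvd 2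


/-! ### Unimodular matrices -/

lemma polyNonneg_leadingCoeff {p : ℝ[X]} (hp : PolyNonneg p) : 0 ≤ p.leadingCoeff := by
  by_contra hlc
  push Not at hlc
  by_cases hd : 0 < p.degree
  · have h := Polynomial.tendsto_atBot_of_leadingCoeff_nonpos p hd hlc.le
    obtain ⟨t, ht⟩ := (h.eventually (Filter.eventually_lt_atBot 0)).exists
    exact absurd (hp t) (not_le.2 ht)
  · have h := Polynomial.eq_C_of_degree_le_zero (not_lt.1 hd)
    have h0 := hp 0
    rw [h] at hlc h0
    simp at hlc h0
    linarith

lemma polyNonneg_even {p : ℝ[X]} (hp : PolyNonneg p) : Even p.natDegree := by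
  by_contra hodd
  rw [Nat.not_even_iff_odd] at hodd
  have h1 := polyNonneg_leadingCoeff hp
  have h2 : PolyNonneg (p.comp (-X)) := fun t => by
    rw [Polynomial.eval_comp]; exact hp _
  have h3 := polyNonneg_leadingCoeff h2
  rw [Polynomial.leadingCoeff_comp (by simp)] at h3
  simp only [Polynomial.leadingCoeff_neg, Polynomial.leadingCoeff_X, hodd.neg_one_pow] at h3
  have h4 : p.leadingCoeff = 0 := by linarith
  rw [Polynomial.leadingCoeff_eq_zero] at h4
  simp [h4] at hodd

lemma natDegree_le_of_sub_nonneg {p q : ℝ[X]} (h : PolyNonneg (q - p ^ 2)) :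
    2 * p.natDegree ≤ q.natDegree := by
  by_contra hlt
  push Not at hlt
  have hp2 : (p ^ 2).natDegree = 2 * p.natDegree := Polynomial.natDegree_pow p 2
  have hd : q.natDegree < (p ^ 2).natDegree := by rw [hp2]; exact hlt
  have h1 := polyNonneg_leadingCoeff h
  rw [Polynomial.leadingCoeff_sub_of_degree_lt' (Polynomial.degree_lt_degree hd),
    Polynomial.leadingCoeff_pow] at h1
  have h2 : p.leadingCoeff = 0 := by nlinarith [sq_nonneg p.leadingCoeff]
  rw [Polynomial.leadingCoeff_eq_zero] at h2
  simp [h2] at hlt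

lemma PolyPSD.diag {M : Matrix ι ι ℝ[X]} (hM : PolyPSD M) (i : ι) : PolyNonneg (M i i) := by
  have := hM.2 (Pi.single i 1)
  simpa using this

lemma PolyPSD.minor {M : Matrix ι ι ℝ[X]} (hM : PolyPSD M) (i j : ι) :
    PolyNonneg (M i i * M j j - M i j ^ 2) := by
  intro t
  have h : ∀ s : ℝ, 0 ≤ (M i i).eval t * (s * s) + (2 * (M i j).eval t) * s + (M j j).eval t := by
    intro s
    have h1 := hM.2 (Polynomial.C s • Pi.single i 1 + Pi.single j 1) t
    have h2 : M j i = M i j := hM.1.apply i j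
    have : (Polynomial.C s • Pi.single i 1 + Pi.single j 1 : ι → ℝ[X]) ⬝ᵥ
        M *ᵥ (Polynomial.C s • Pi.single i 1 + Pi.single j 1) =
        M i i * (C s * C s) + 2 * M i j * C s + M j j := by
      rw [Matrix.mulVec_add, Matrix.mulVec_smul, add_dotProduct, dotProduct_add, dotProduct_add,
        smul_dotProduct, smul_dotProduct, dotProduct_smul, dotProduct_smul]
      simp only [smul_eq_mul, Matrix.mulVec_single_one, single_one_dotProduct, Matrix.col_apply, h2]
      ring
    rw [this] at h1
    simpa using h1
  have := discrim_le_zero h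
  simp only [discrim] at this
  simp only [Polynomial.eval_sub, Polynomial.eval_mul, Polynomial.eval_pow]
  nlinarith

lemma PolyPSD.diag_ne_zero {M : Matrix ι ι ℝ[X]} (hM : PolyPSD M) (h : M.det ≠ 0) (i : ι) :
    M i i ≠ 0 := by
  intro h0
  apply h
  apply Matrix.det_eq_zero_of_row_eq_zero i
  intro j
  have h1 := hM.minor i j
  rw [h0, zero_mul, zero_sub] at h1
  refine Polynomial.funext fun t => ?_
  have := h1 t
  simp only [Polynomial.eval_neg, Polynomial.eval_pow] at this
  simp only [Polynomial.eval_zero]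
  nlinarith [sq_nonneg ((M i j).eval t)]

lemma coeff_det_uniform (A : Matrix ι ι ℝ[X]) (K : ℕ) (hA : ∀ i j, (A i j).natDegree ≤ K) :
    A.det.coeff (Fintype.card ι * K) = (Matrix.of fun i j => (A i j).coeff K).det := by
  rw [Matrix.det_apply, Matrix.det_apply, Polynomial.finsetSum_coeff]
  refine Finset.sum_congr rfl fun σ _ => ?_
  rw [Polynomial.coeff_smul]
  congr 1
  have := Polynomial.coeff_prod_of_natDegree_le (s := (Finset.univ : Finset ι))
    (fun i => A (σ i) i) K (fun i _ => hA _ _)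
  rw [Finset.card_univ] at this
  rw [this]
  rfl

/-- The matrix of leading coefficients of a unimodular matrix that is not constant is singular. -/
lemma lead_singular {M : Matrix ι ι ℝ[X]} {γ : ℝ} (hdet : M.det = C γ) (δ : ι → ℕ)
    (hδ : ∀ i j, (M i j).natDegree ≤ δ i + δ j) (hpos : 0 < ∑ i, δ i) :
    (Matrix.of fun i j => (M i j).coeff (δ i + δ j)).det = 0 := by
  set K := ∑ i, δ i with hK
  have hle : ∀ i, δ i ≤ K := fun i => Finset.single_le_sum (fun _ _ => Nat.zero_le _)
    (Finset.mem_univ i)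
  set D : Matrix ι ι ℝ[X] := diagonal fun i => X ^ (K - δ i) with hD
  have hent : ∀ i j, (D * M * D) i j = M i j * X ^ ((K - δ i) + (K - δ j)) := by
    intro i j
    rw [hD, Matrix.mul_diagonal, Matrix.diagonal_mul, pow_add]
    ring
  have hdeg : ∀ i j, ((D * M * D) i j).natDegree ≤ 2 * K := by
    intro i j
    rw [hent]
    refine (Polynomial.natDegree_mul_le_of_le (hδ i j) (Polynomial.natDegree_X_pow_le _)).trans ?_
    have := hle i
    have := hle j
    omega
  have h := coeff_det_uniform (D * M * D) (2 * K) hdeg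
  have hco : ∀ i j, ((D * M * D) i j).coeff (2 * K) = (M i j).coeff (δ i + δ j) := by
    intro i j
    rw [hent, show 2 * K = (δ i + δ j) + ((K - δ i) + (K - δ j)) by
      have := hle i
      have := hle j
      omega, Polynomial.coeff_mul_X_pow]
  simp only [hco] at h
  rw [← h, Matrix.det_mul, Matrix.det_mul, hdet, hD, Matrix.det_diagonal, Finset.prod_pow_eq_pow_sum]
  have hsum : ∑ i, (K - δ i) + K = Fintype.card ι * K := by
    conv_lhs => rw [hK]
    rw [← hK, ← Finset.sum_add_distrib, Finset.sum_congr rfl (fun i _ => Nat.sub_add_cancel (hle i))]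
    simp
  rw [show (X ^ (∑ i, (K - δ i)) * C γ * X ^ (∑ i, (K - δ i)) : ℝ[X]) =
    C γ * X ^ (∑ i, (K - δ i) + ∑ i, (K - δ i)) by rw [pow_add]; ring]
  rw [Polynomial.coeff_C_mul_X_pow, if_neg]
  nlinarith

open scoped MatrixOrder in
lemma real_psd_factor {A : Matrix ι ι ℝ} (hA : A.PosSemidef) : ∃ B : Matrix ι ι ℝ, A = Bᴴ * B := by
  obtain ⟨B, hB⟩ := CStarAlgebra.nonneg_iff_eq_star_mul_self.mp hA.nonneg
  exact ⟨B, hB⟩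

lemma const_case {M : Matrix ι ι ℝ[X]} (hM : PolyPSD M) (h0 : ∀ i j, (M i j).natDegree = 0) :
    ∃ B : Matrix ι ι ℝ[X], M = Bᵀ * B := by
  set A : Matrix ι ι ℝ := Matrix.of fun i j => (M i j).coeff 0 with hA
  have hMA : M = A.map C := by
    ext1 i j
    simp only [hA, Matrix.map_apply, Matrix.of_apply]
    exact Polynomial.eq_C_of_natDegree_eq_zero (h0 i j)
  have hpsd : A.PosSemidef := by
    refine Matrix.PosSemidef.of_dotProduct_mulVec_nonneg ?_ ?_
    · ext i j
      simp only [hA, Matrix.conjTranspose_apply, Matrix.of_apply, star_trivial, hM.1.apply i j]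
    · intro x
      have h := hM.2 (fun i => C (x i)) 0
      refine h.trans_eq ?_
      rw [hMA]
      simp [dotProduct, Matrix.mulVec, Polynomial.eval_finsetSum]
  obtain ⟨B, hB⟩ := real_psd_factor hpsd
  refine ⟨B.map C, ?_⟩
  rw [hMA, hB, Matrix.map_mul]
  rfl

lemma unimodular_factor (n : ℕ) : ∀ (M : Matrix ι ι ℝ[X]), PolyPSD M →
    ∀ γ : ℝ, γ ≠ 0 → M.det = C γ → ∑ i, (M i i).natDegree = n →
    ∃ B : Matrix ι ι ℝ[X], M = Bᵀ * B := by
  induction n using Nat.strong_induction_on with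
  | _ n ih =>
  intro M hM γ hγ hdet hn
  choose δ hδ using fun i => polyNonneg_even (hM.diag i)
  have hdeg : ∀ i j, (M i j).natDegree ≤ δ i + δ j := by
    intro i j
    have h1 := natDegree_le_of_sub_nonneg (hM.minor i j)
    have h2 : (M i i * M j j).natDegree ≤ _ := Polynomial.natDegree_mul_le
    rw [hδ i, hδ j] at h2
    omega
  rcases Nat.eq_zero_or_pos (∑ i, δ i) with hz | hpos
  · have hz' : ∀ i, δ i = 0 := fun i => by
      rw [Finset.sum_eq_zero_iff] at hz; exact hz i (Finset.mem_univ i)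
    refine const_case hM fun i j => ?_
    have := hdeg i j
    rw [hz' i, hz' j] at this
    omega
  obtain ⟨c, hc0, hc⟩ := Matrix.exists_mulVec_eq_zero_iff.2 (lead_singular hdet δ hdeg hpos)
  obtain ⟨i0, hi0⟩ := Function.ne_iff.1 hc0
  obtain ⟨i, hi, hmax⟩ := Finset.exists_max_image (Finset.univ.filter fun i => c i ≠ 0) δ
    ⟨i0, by simpa using hi0⟩
  simp only [Finset.mem_filter, Finset.mem_univ, true_and] at hi hmax
  set u : ι → ℝ[X] := fun j => C (c j) * X ^ (δ i - δ j) with hu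
  set E := (1 : Matrix ι ι ℝ[X]).updateCol i u with hE
  have hdetE : E.det = C (c i) := by rw [hE, det_colMat, hu]; simp
  have hunit : IsUnit E.det := by
    rw [hdetE]; exact Polynomial.isUnit_C.2 (isUnit_iff_ne_zero.2 hi)
  set N := Eᵀ * M * E with hN
  have hNP : PolyPSD N := hM.congr E
  have hdetN : N.det = C (c i * γ * c i) := by
    rw [hN, Matrix.det_mul, Matrix.det_mul, Matrix.det_transpose, hdetE, hdet]; simp
  have hne : c i * γ * c i ≠ 0 := mul_ne_zero (mul_ne_zero hi hγ) hi
  have hNj : ∀ j, j ≠ i → N j j = M j j := by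
    intro j hj
    rw [hN, congr_entry, hE, colMat_mulVec_ne i j hj]
    simp
  have hNi : N i i = ∑ j, ∑ k, C (c j * c k) * (X ^ ((δ i - δ j) + (δ i - δ k)) * M j k) := by
    rw [hN, congr_entry, hE, colMat_mulVec]
    simp only [dotProduct, Matrix.mulVec, hu, Finset.mul_sum]
    refine Finset.sum_congr rfl fun j _ => Finset.sum_congr rfl fun k _ => ?_
    rw [pow_add, Polynomial.C_mul]; ring
  have hNdeg : (N i i).natDegree ≤ δ i + δ i := by
    rw [hNi]
    refine Polynomial.natDegree_sum_le_of_forall_le _ _ fun j _ =>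
      Polynomial.natDegree_sum_le_of_forall_le _ _ fun k _ => ?_
    by_cases hj : c j = 0
    · simp [hj]
    by_cases hk : c k = 0
    · simp [hk]
    refine (Polynomial.natDegree_C_mul_le _ _).trans ((Polynomial.natDegree_mul_le_of_le
      (Polynomial.natDegree_X_pow_le _) (hdeg j k)).trans ?_)
    have := hmax j hj
    have := hmax k hk
    omega
  have hNco : (N i i).coeff (δ i + δ i) = 0 := by
    have hterm : ∀ j k, (C (c j * c k) * (X ^ ((δ i - δ j) + (δ i - δ k)) * M j k)).coeff (δ i + δ i)
        = c j * ((M j k).coeff (δ j + δ k) * c k) := by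
      intro j k
      by_cases hj : c j = 0
      · simp [hj]
      by_cases hk : c k = 0
      · simp [hk]
      have h1 := hmax j hj
      have h2 := hmax k hk
      rw [Polynomial.coeff_C_mul, show δ i + δ i = (δ j + δ k) + ((δ i - δ j) + (δ i - δ k)) by omega,
        Polynomial.coeff_X_pow_mul]
      ring
    rw [hNi, Polynomial.finsetSum_coeff]
    simp only [Polynomial.finsetSum_coeff, hterm, ← Finset.mul_sum]
    refine Finset.sum_eq_zero fun j _ => ?_
    have := congrFun hc j
    simp only [Matrix.mulVec, dotProduct, Matrix.of_apply, Pi.zero_apply] at this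
    rw [this, mul_zero]
  have hNne : N i i ≠ 0 := hNP.diag_ne_zero (by rw [hdetN]; simpa using hne) i
  have hlt : (N i i).natDegree < δ i + δ i := by
    refine lt_of_le_of_ne hNdeg fun heq => ?_
    rw [← heq, Polynomial.coeff_natDegree, Polynomial.leadingCoeff_eq_zero] at hNco
    exact hNne hNco
  have hsum : ∑ j, (N j j).natDegree < n := by
    rw [← hn]
    refine Finset.sum_lt_sum (fun j _ => ?_) ⟨i, Finset.mem_univ i, by rw [hδ i]; exact hlt⟩
    by_cases hj : j = i
    · subst hj; rw [hδ j]; exact hlt.le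
    · rw [hNj j hj]
  obtain ⟨B, hB⟩ := ih _ hsum N hNP _ hne hdetN rfl
  refine ⟨B * E⁻¹, ?_⟩
  rw [colMat_undo M E hunit, ← hN, hB, Matrix.transpose_mul]
  simp only [Matrix.mul_assoc]

/-- A psd polynomial matrix whose determinant is a nonzero square is a hermitian square. -/
lemma square_det_factor (n : ℕ) : ∀ (M : Matrix ι ι ℝ[X]), PolyPSD M →
    ∀ g : ℝ[X], g ≠ 0 → M.det = g ^ 2 → g.natDegree = n →
    ∃ B : Matrix ι ι ℝ[X], M = Bᵀ * B := by
  induction n using Nat.strong_induction_on with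
  | _ n ih =>
  intro M hM g hg hdet hn
  rcases Nat.eq_zero_or_pos g.natDegree with hz | hpos
  · have h1 := Polynomial.eq_C_of_natDegree_eq_zero hz
    refine unimodular_factor _ M hM (g.coeff 0 ^ 2) ?_ ?_ rfl
    · intro h0
      apply hg
      rw [h1, pow_eq_zero_iff two_ne_zero |>.1 h0, C_0]
    · rw [hdet, C_pow, ← h1]
  · obtain ⟨D, M', g', h1, h2, h3, h4, h5⟩ := det_reduce hM hg hdet hpos
    obtain ⟨B, hB⟩ := ih _ (by omega) M' h1 g' h4 h3 rfl
    refine ⟨B * D, ?_⟩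
    rw [h2, hB, Matrix.transpose_mul]
    simp only [Matrix.mul_assoc]

/-- A nondegenerate Gram matrix of size `s` is a sum of `s + 1` squares. -/
lemma gram_nondeg {r : ℕ} (Q : Matrix (Fin r) ι ℝ[X]) (hQ : (Qᵀ * Q).det ≠ 0) :
    ∃ B : Matrix (ι ⊕ Unit) ι ℝ[X], Qᵀ * Q = Bᵀ * B := by
  set G := Qᵀ * Q with hG
  have hGs : G.IsSymm := by
    unfold Matrix.IsSymm
    rw [hG, Matrix.transpose_mul, Matrix.transpose_transpose]
  have hGP : ∀ v : ι → ℝ[X], PolyNonneg (v ⬝ᵥ G *ᵥ v) := by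
    intro v t
    have : v ⬝ᵥ G *ᵥ v = (Q *ᵥ v) ⬝ᵥ (Q *ᵥ v) := by
      rw [hG, ← Matrix.mulVec_mulVec, Matrix.dotProduct_mulVec, Matrix.vecMul_transpose]
    rw [this, dotProduct, Polynomial.eval_finsetSum]
    refine Finset.sum_nonneg fun k _ => ?_
    rw [Polynomial.eval_mul]
    exact mul_self_nonneg _
  have hdetN : PolyNonneg G.det := by
    intro t
    have h1 : G.det.eval t = ((Q.map (eval t))ᵀ * Q.map (eval t)).det := by
      have h3 := RingHom.map_det (evalRingHom t) G
      rw [Polynomial.coe_evalRingHom] at h3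
      rw [h3, hG, RingHom.mapMatrix_apply, Matrix.map_mul]
      rfl
    rw [h1]
    have h2 := (Matrix.posSemidef_conjTranspose_mul_self (Q.map (eval t))).det_nonneg
    simpa using h2
  set M : Matrix (ι ⊕ Unit) (ι ⊕ Unit) ℝ[X] := Matrix.fromBlocks G 0 0 (Matrix.of fun _ _ => G.det)
    with hM
  have hMP : PolyPSD M := by
    refine ⟨?_, fun v => ?_⟩
    · exact Matrix.IsSymm.fromBlocks hGs (by simp) (by ext; simp)
    · intro t
      have : v ⬝ᵥ M *ᵥ v = (v ∘ Sum.inl) ⬝ᵥ G *ᵥ (v ∘ Sum.inl) +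
          G.det * v (Sum.inr ()) ^ 2 := by
        rw [hM, Matrix.fromBlocks_mulVec]
        simp [dotProduct, Matrix.mulVec, Fintype.sum_sum_type]
        ring
      rw [this, Polynomial.eval_add, Polynomial.eval_mul, Polynomial.eval_pow]
      have h1 := hGP (v ∘ Sum.inl) t
      have h2 := hdetN t
      positivity
  have hMdet : M.det = G.det ^ 2 := by
    rw [hM, Matrix.det_fromBlocks_zero₂₁]
    simp [sq]
  obtain ⟨B, hB⟩ := square_det_factor _ M hMP G.det hQ hMdet rfl
  refine ⟨B.submatrix id Sum.inl, ?_⟩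
  ext1 i j
  have := congrFun (congrFun hB (Sum.inl i)) (Sum.inl j)
  rw [hM, Matrix.fromBlocks_apply₁₁] at this
  rw [this]
  rfl

end PolyMat

section Translate

open Polynomial Matrix

/-- Every `n × n` Gram matrix over `ℝ[X]` is a sum of `n + 1` squares. -/
lemma gram_general {r n : ℕ} (P : Matrix (Fin r) (Fin n) ℝ[X]) :
    ∃ B : Matrix (Fin (n + 1)) (Fin n) ℝ[X], Pᵀ * P = Bᵀ * B := by
  set L := LinearMap.range P.mulVecLin with hL
  obtain ⟨s, b⟩ := Submodule.basisOfPid (Pi.basisFun ℝ[X] (Fin r)) L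
  have hs : s ≤ n := by
    have h1 : Module.finrank ℝ[X] L ≤ Module.finrank ℝ[X] (Fin n → ℝ[X]) :=
      LinearMap.finrank_range_le P.mulVecLin
    rw [Module.finrank_eq_card_basis b] at h1
    simpa using h1
  set Q : Matrix (Fin r) (Fin s) ℝ[X] := Matrix.of fun k j => (b j : Fin r → ℝ[X]) k with hQ
  have hQw : ∀ w : Fin s → ℝ[X], Q *ᵥ w = ((∑ j, w j • b j : L) : Fin r → ℝ[X]) := by
    intro w
    ext1 k
    simp [hQ, Matrix.mulVec, dotProduct, mul_comm]
  have hdet : (Qᵀ * Q).det ≠ 0 := by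
    intro h0
    obtain ⟨w, hw0, hw⟩ := Matrix.exists_mulVec_eq_zero_iff.2 h0
    have h1 : (Q *ᵥ w) ⬝ᵥ (Q *ᵥ w) = 0 := by
      have : w ⬝ᵥ (Qᵀ * Q) *ᵥ w = (Q *ᵥ w) ⬝ᵥ (Q *ᵥ w) := by
        rw [← Matrix.mulVec_mulVec, Matrix.dotProduct_mulVec, Matrix.vecMul_transpose]
      rw [← this, hw, dotProduct_zero]
    have h2 : Q *ᵥ w = 0 := by
      ext1 k
      refine Polynomial.funext fun t => ?_
      have h3 := congrArg (eval t) h1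
      simp only [dotProduct, Polynomial.eval_finsetSum, Polynomial.eval_mul,
        Polynomial.eval_zero] at h3
      rw [Finset.sum_eq_zero_iff_of_nonneg (fun _ _ => mul_self_nonneg _)] at h3
      simpa using h3 k (Finset.mem_univ k)
    rw [hQw] at h2
    have h4 : ∑ j, w j • b j = 0 := Subtype.ext h2
    exact hw0 (funext fun j => Fintype.linearIndependent_iff.1 b.linearIndependent w h4 j)
  obtain ⟨B, hB⟩ := gram_nondeg Q hdet
  set T : Matrix (Fin s) (Fin n) ℝ[X] := Matrix.of fun j i =>
    b.repr ⟨P *ᵥ Pi.single i 1, ⟨Pi.single i 1, rfl⟩⟩ j with hT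
  have hPQ : P = Q * T := by
    ext1 k i
    have h1 := hQw (fun j => T j i)
    have h2 := b.sum_repr ⟨P *ᵥ Pi.single i 1, ⟨Pi.single i 1, rfl⟩⟩
    have h3 : Q *ᵥ (fun j => T j i) = P *ᵥ Pi.single i 1 := by
      rw [h1]; exact congrArg Subtype.val h2
    have h4 := congrFun h3 k
    simp only [Matrix.mulVec_single_one, Matrix.col_apply] at h4
    rw [← h4]; rfl
  have hfac : Pᵀ * P = (B * T)ᵀ * (B * T) := by
    calc Pᵀ * P = Tᵀ * (Qᵀ * Q) * T := by
          rw [hPQ, Matrix.transpose_mul]; simp only [Matrix.mul_assoc]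
      _ = _ := by rw [hB, Matrix.transpose_mul]; simp only [Matrix.mul_assoc]
  obtain ⟨e⟩ : Nonempty ((Fin s ⊕ Unit) ↪ Fin (n + 1)) := by
    rw [Function.Embedding.nonempty_iff_card_le]
    simpa using hs
  refine ⟨Matrix.of fun k i => Function.extend e (fun l => (B * T) l i) 0 k, ?_⟩
  rw [hfac]
  ext1 i j
  simp only [Matrix.mul_apply, Matrix.transpose_apply, Matrix.of_apply]
  symm
  rw [← Finset.sum_subset (Finset.subset_univ (Finset.univ.map e))]
  · rw [Finset.sum_map]
    simp [e.injective.extend_apply]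
  · intro k _ hk
    rw [Function.extend_apply', Pi.zero_apply, zero_mul]
    rintro ⟨a, rfl⟩
    exact hk (by simp)

/-- Dehomogenization. -/
def dehom : MvPolynomial (Fin 3) ℝ →ₐ[ℝ] ℝ[X][X] := MvPolynomial.aeval ![C X, 1, X]

lemma dehom_eval (f : MvPolynomial (Fin 3) ℝ) (a c : ℝ) :
    ((dehom f).eval (C c)).eval a = MvPolynomial.eval ![a, 1, c] f := by
  have : ((evalRingHom a).comp (evalRingHom (C c))).comp dehom.toRingHom =
      MvPolynomial.eval ![a, 1, c] := by
    apply MvPolynomial.ringHom_ext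
    · intro r
      simp [dehom, Polynomial.algebraMap_apply]
    · intro i; fin_cases i <;> simp [dehom]
  exact congrArg (fun φ => φ f) this

lemma homog_eval_smul {e : ℕ} {f : MvPolynomial (Fin 3) ℝ} (hf : f.IsHomogeneous e) (c : ℝ)
    (x : Fin 3 → ℝ) : MvPolynomial.eval (c • x) f = c ^ e * MvPolynomial.eval x f := by
  rw [MvPolynomial.eval_eq', MvPolynomial.eval_eq', Finset.mul_sum]
  refine Finset.sum_congr rfl fun m hm => ?_
  have hm' : m 0 + m 1 + m 2 = e := by
    have := hf (MvPolynomial.mem_support_iff.1 hm)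
    simpa [Finsupp.weight_apply, Finsupp.sum_fintype, Fin.sum_univ_three] using this
  simp only [Fin.prod_univ_three, Pi.smul_apply, smul_eq_mul, mul_pow, ← hm', pow_add]
  ring

lemma dehom_inj {e : ℕ} {f : MvPolynomial (Fin 3) ℝ} (hf : f.IsHomogeneous e) (h : dehom f = 0) :
    f = 0 := by
  have h1 : MvPolynomial.X 1 * f = 0 := by
    refine MvPolynomial.funext fun x => ?_
    rw [map_mul, MvPolynomial.eval_X, map_zero]
    by_cases hx : x 1 = 0
    · rw [hx, zero_mul]
    · have h2 := dehom_eval f (x 0 / x 1) (x 2 / x 1)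
      rw [h] at h2
      have h3 : x = x 1 • ![x 0 / x 1, 1, x 2 / x 1] := by
        ext i
        fin_cases i <;> simp <;> field_simp
      rw [h3, homog_eval_smul hf, ← h2]
      simp
  exact (mul_eq_zero.1 h1).resolve_left (MvPolynomial.X_ne_zero 1)

lemma dehom_form (d : ℕ) (p : MvPolynomial (Fin 3) ℝ) (hp : p.IsHomogeneous d) :
    ∃ P : Fin (d + 1) → ℝ[X], (∀ i, (P i).natDegree ≤ i) ∧
      dehom p = ∑ i : Fin (d + 1), C (P i) * X ^ (d - (i : ℕ)) := by
  refine ⟨fun i => ∑ m ∈ p.support, if (i : ℕ) + m 2 = d then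
    C (p.coeff m) * X ^ (m 0) else 0, fun i => ?_, ?_⟩
  · refine Polynomial.natDegree_sum_le_of_forall_le _ _ fun m hm => ?_
    have hm' : m 0 + (m 1 + m 2) = d := by
      have := hp (MvPolynomial.mem_support_iff.1 hm)
      simpa [Finsupp.weight_apply, Finsupp.sum_fintype, Fin.sum_univ_three, add_assoc] using this
    split_ifs with h
    · exact (Polynomial.natDegree_C_mul_X_pow_le _ _).trans (by omega)
    · simp
  · rw [dehom, MvPolynomial.aeval_def, MvPolynomial.eval₂_eq']
    simp only [map_sum, Finset.sum_mul]
    rw [Finset.sum_comm]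
    refine Finset.sum_congr rfl fun m hm => ?_
    have hm' : m 0 + (m 1 + m 2) = d := by
      have := hp (MvPolynomial.mem_support_iff.1 hm)
      simpa [Finsupp.weight_apply, Finsupp.sum_fintype, Fin.sum_univ_three, add_assoc] using this
    rw [Finset.sum_eq_single (⟨d - m 2, by omega⟩ : Fin (d + 1))]
    · rw [if_pos (by simp only; omega), Fin.prod_univ_three]
      simp only [show d - (d - m 2) = m 2 by omega]
      simp [Polynomial.algebraMap_apply, mul_assoc]
    · intro i _ hi
      rw [if_neg, map_zero, zero_mul]
      intro h
      exact hi (Fin.ext (by simp only; omega))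
    · simp

/-- The form with given dehomogenization. -/
def rehom (d : ℕ) (b : Fin (d + 1) → ℝ[X]) : MvPolynomial (Fin 3) ℝ :=
  ∑ i : Fin (d + 1), ∑ j ∈ Finset.range ((i : ℕ) + 1),
    MvPolynomial.C ((b i).coeff j) * (MvPolynomial.X 0 ^ j *
      MvPolynomial.X 1 ^ ((i : ℕ) - j) * MvPolynomial.X 2 ^ (d - (i : ℕ)))

lemma rehom_homog (d : ℕ) (b : Fin (d + 1) → ℝ[X]) : (rehom d b).IsHomogeneous d := by
  refine MvPolynomial.IsHomogeneous.sum _ _ _ fun i _ =>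
    MvPolynomial.IsHomogeneous.sum _ _ _ fun j hj => ?_
  have hj' := Finset.mem_range.1 hj
  have h := (MvPolynomial.isHomogeneous_C (Fin 3) ((b i).coeff j)).mul
    (((MvPolynomial.isHomogeneous_X_pow (R := ℝ) (0 : Fin 3) j).mul
    (MvPolynomial.isHomogeneous_X_pow (R := ℝ) (1 : Fin 3) ((i : ℕ) - j))).mul
    (MvPolynomial.isHomogeneous_X_pow (R := ℝ) (2 : Fin 3) (d - (i : ℕ))))
  convert h using 1
  omega

lemma dehom_rehom (d : ℕ) (b : Fin (d + 1) → ℝ[X]) (hb : ∀ i, (b i).natDegree ≤ i) :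
    dehom (rehom d b) = ∑ i : Fin (d + 1), C (b i) * X ^ (d - (i : ℕ)) := by
  rw [rehom, map_sum]
  refine Finset.sum_congr rfl fun i _ => ?_
  rw [map_sum]
  conv_rhs => rw [Polynomial.as_sum_range' (b i) ((i : ℕ) + 1) (Nat.lt_succ_of_le (hb i))]
  rw [map_sum, Finset.sum_mul]
  refine Finset.sum_congr rfl fun j _ => ?_
  rw [← Polynomial.C_mul_X_pow_eq_monomial]
  simp [dehom, Polynomial.algebraMap_apply, mul_assoc]

lemma sum_sq_gram {r n : ℕ} (P : Matrix (Fin r) (Fin n) ℝ[X]) (Y : Fin n → ℝ[X][X]) :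
    ∑ k, (∑ i, C (P k i) * Y i) ^ 2 = ∑ i, ∑ j, C ((Pᵀ * P) i j) * (Y i * Y j) := by
  have h : ∀ k, (∑ i, C (P k i) * Y i) ^ 2 =
      ∑ i, ∑ j, C (P k i * P k j) * (Y i * Y j) := by
    intro k
    rw [sq, Finset.sum_mul_sum]
    refine Finset.sum_congr rfl fun i _ => Finset.sum_congr rfl fun j _ => ?_
    rw [C_mul]; ring
  simp only [h]
  rw [Finset.sum_comm]
  refine Finset.sum_congr rfl fun i _ => ?_
  rw [Finset.sum_comm]
  refine Finset.sum_congr rfl fun j _ => ?_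
  rw [Matrix.mul_apply, map_sum, Finset.sum_mul]
  rfl

lemma natDegree_of_sum_sq {r : ℕ} (b : Fin r → ℝ[X]) (D : ℕ)
    (h : (∑ k, b k * b k).natDegree ≤ D + D) (k : Fin r) : (b k).natDegree ≤ D := by
  have h1 : PolyNonneg (∑ k, b k * b k - b k ^ 2) := by
    intro t
    rw [← Finset.add_sum_erase _ _ (Finset.mem_univ k)]
    rw [show b k * b k + ∑ x ∈ Finset.univ.erase k, b x * b x - b k ^ 2 =
      ∑ x ∈ Finset.univ.erase k, b x * b x by ring, Polynomial.eval_finsetSum]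
    refine Finset.sum_nonneg fun x _ => ?_
    rw [Polynomial.eval_mul]; exact mul_self_nonneg _
  have := natDegree_le_of_sub_nonneg h1
  omega

lemma upper_bound (d : ℕ) (f : MvPolynomial (Fin 3) ℝ) (hf : InSigma 3 d f) :
    IsSOS 3 d (d + 2) f := by
  obtain ⟨r, p, hp, rfl⟩ := hf
  choose P hPdeg hP using fun k => dehom_form d (p k) (hp k)
  obtain ⟨B, hB⟩ := gram_general (Matrix.of P)
  have hBdeg : ∀ k i, (B k i).natDegree ≤ (i : ℕ) := by
    intro k i
    refine natDegree_of_sum_sq (fun k => B k i) i ?_ k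
    have h1 := congrFun (congrFun hB i) i
    simp only [Matrix.mul_apply, Matrix.transpose_apply, Matrix.of_apply] at h1
    rw [← h1]
    exact Polynomial.natDegree_sum_le_of_forall_le _ _ fun l _ =>
      Polynomial.natDegree_mul_le_of_le (hPdeg l i) (hPdeg l i)
  refine ⟨fun k => rehom d (B k), fun k => rehom_homog d _, ?_⟩
  have hhom : ∀ {s : ℕ} (q : Fin s → MvPolynomial (Fin 3) ℝ), (∀ k, (q k).IsHomogeneous d) →
      (∑ k, q k ^ 2).IsHomogeneous (d * 2) := fun q hq =>
    MvPolynomial.IsHomogeneous.sum _ _ _ fun k _ => (hq k).pow 2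
  rw [← sub_eq_zero]
  refine dehom_inj ((hhom p hp).sub (hhom _ fun k => rehom_homog d (B k))) ?_
  rw [map_sub, map_sum, map_sum, sub_eq_zero]
  simp only [map_pow, hP, dehom_rehom d _ (hBdeg _)]
  have h2 := sum_sq_gram (Matrix.of P) (fun i : Fin (d + 1) => (X : ℝ[X][X]) ^ (d - (i : ℕ)))
  have h3 := sum_sq_gram B (fun i : Fin (d + 1) => (X : ℝ[X][X]) ^ (d - (i : ℕ)))
  rw [hB] at h2
  exact h2.trans h3.symm

end Translate

/-- For `d ≥ 2` the ternary Pythagoras number satisfies `d+1 ≤ p(3,2d) ≤ d+2`: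
every sum of squares of degree-`d` forms in `ℝ[x₁,x₂,x₃]` is a sum of `d+2`
squares, and some such form is not a sum of `d` squares. -/
theorem ternary_pythagoras_bounds (d : ℕ) (hd : 2 ≤ d) :
    (∀ f : MvPolynomial (Fin 3) ℝ, InSigma 3 d f → IsSOS 3 d (d + 2) f) ∧
    (∃ f : MvPolynomial (Fin 3) ℝ, InSigma 3 d f ∧ ¬ IsSOS 3 d d f) :=
  ⟨upper_bound d, _, ⟨d + 1, lineForm d, lineForm_homog d, rfl⟩, not_sos d⟩
end
end

section
/- p(3,6) = 4: every form of degree 6 in ℝ[x_1,x_2,x_3] that is a sum of squares of cubic forms is a sum of four squares of cubic forms, and there exists such a form that is not a sum of three squares of cubic forms. -/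
open MvPolynomial

noncomputable section

namespace TS

abbrev S := MvPolynomial (Fin 3) ℝ

theorem hc_mul {w : S} {i : ℕ} (hw : w.IsHomogeneous i) (c : S) (n : ℕ) :
    homogeneousComponent n (w * c) = if i ≤ n then w * homogeneousComponent (n - i) c else 0 := by
  letI : GradedAlgebra (homogeneousSubmodule (Fin 3) ℝ) := MvPolynomial.gradedAlgebra
  have h := DirectSum.coe_decompose_mul_of_left_mem (𝒜 := homogeneousSubmodule (Fin 3) ℝ)
    (a := w) (b := c) (i := i) n hw
  have e : ∀ (p : S) (m : ℕ), (DirectSum.decompose (homogeneousSubmodule (Fin 3) ℝ) p m : S)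
      = homogeneousComponent m p := fun p m => decomposition.decompose'_apply p m
  rw [e, e] at h
  exact h

theorem hc_self {p : S} {n : ℕ} (hp : p.IsHomogeneous n) : homogeneousComponent n p = p :=
  homogeneousComponent_eq_self hp

/-- Set the last variable to zero. -/
def kz : S →ₐ[ℝ] S := aeval ![X 0, X 1, 0]

theorem kz_dvd (c : S) : (X 2 : S) ∣ c - kz c := by
  induction c using MvPolynomial.induction_on with
  | C a => simp [kz]
  | add p q hp hq =>
    have : p + q - kz (p + q) = (p - kz p) + (q - kz q) := by rw [map_add]; ring
    rw [this]; exact dvd_add hp hq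
  | mul_X p i hp =>
    have : p * X i - kz (p * X i) = (p - kz p) * X i + kz p * (X i - kz (X i)) := by
      rw [map_mul]; ring
    rw [this]
    refine dvd_add (hp.mul_right _) (Dvd.dvd.mul_left ?_ _)
    fin_cases i <;> simp [kz]

theorem kz_X2 : kz (X 2) = 0 := by simp [kz]
theorem kz_X1 : kz (X 1) = X 1 := by simp [kz]
theorem kz_X0 : kz (X 0) = X 0 := by simp [kz]

theorem xy_reg0 {c c' : S} (h : X 1 * c = X 0 * c') : ∃ d, c = X 0 * d ∧ c' = X 1 * d := by
  have h1 : (X 0 : S) ∣ X 1 * c := ⟨c', h⟩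
  rcases (X_prime (R := ℝ) (i := (0 : Fin 3))).dvd_or_dvd h1 with h2 | ⟨d, hd⟩
  · rw [X_dvd_X] at h2
    simp at h2
  · refine ⟨d, hd, ?_⟩
    have hx : (X 0 : S) ≠ 0 := X_ne_zero _
    apply mul_left_cancel₀ hx
    rw [← h, hd]; ring

theorem xy_reg {c c' : S} (h : (X 2 : S) ∣ X 1 * c - X 0 * c') :
    ∃ d, (X 2 : S) ∣ c - X 0 * d ∧ (X 2 : S) ∣ c' - X 1 * d := by
  obtain ⟨g, hg⟩ := h
  have h0 : X 1 * kz c = X 0 * kz c' := by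
    have := congrArg kz hg
    simp only [map_sub, map_mul, kz_X0, kz_X1, kz_X2, zero_mul] at this
    exact sub_eq_zero.mp this
  obtain ⟨d, h1, h2⟩ := xy_reg0 h0
  refine ⟨d, ?_, ?_⟩
  · rw [← h1]; exact kz_dvd c
  · rw [← h2]; exact kz_dvd c'

theorem avoid (W : Submodule ℝ S) (Ps : Set (Ideal S)) (hf : Ps.Finite)
    (hP : ∀ P ∈ Ps, ∃ w ∈ W, w ∉ P) : ∃ w ∈ W, ∀ P ∈ Ps, w ∉ P := by
  classical
  have := hf.to_subtype
  by_contra hcon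
  push Not at hcon
  have := Subspace.exists_eq_top_of_iUnion_eq_univ (k := ℝ) (E := W) (ι := Ps)
    (p := fun P => ((P : Ideal S).restrictScalars ℝ).comap W.subtype) (by
      ext w
      simp only [Set.mem_iUnion, Set.mem_univ, iff_true]
      obtain ⟨P, hPs, h⟩ := hcon w w.2
      exact ⟨⟨P, hPs⟩, h⟩)
  obtain ⟨P, h⟩ := this
  obtain ⟨w, hw, hn⟩ := hP P P.2
  have : (⟨w, hw⟩ : W) ∈ ((P : Ideal S).restrictScalars ℝ).comap W.subtype := by rw [h]; trivial
  exact hn this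

/-- Nonzerodivisor modulo `I`. -/
def NZ (I : Ideal S) (w : S) : Prop := ∀ a, w * a ∈ I → a ∈ I

theorem assoc_no (W : Submodule ℝ S)
    (hW : ∀ P : Ideal S, P.IsPrime → (∀ w ∈ W, w ∈ P) → ∀ j, X j ∈ P) (I : Ideal S)
    (hI : ∀ a, (∀ j, X j * a ∈ I) → a ∈ I) :
    ∀ P ∈ associatedPrimes S (S ⧸ I), ∃ w ∈ W, w ∉ P := by
  intro P hP
  rw [AssociatedPrimes.mem_iff, isAssociatedPrime_iff] at hP
  obtain ⟨hpr, y, hy⟩ := hP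
  by_contra hcon
  push Not at hcon
  have hX := hW P hpr hcon
  obtain ⟨a, rfl⟩ := Ideal.Quotient.mk_surjective y
  have key : ∀ r : S, r ∈ P ↔ r * a ∈ I := by
    intro r
    rw [hy, Submodule.mem_colon_singleton, Submodule.mem_bot, ← Ideal.Quotient.eq_zero_iff_mem]
    rfl
  have ha : a ∈ I := hI a fun j => (key _).1 (hX j)
  apply hpr.ne_top
  rw [Ideal.eq_top_iff_one, key]
  simpa using ha

theorem nz_of_avoid (I : Ideal S) (w : S) (h : ∀ P ∈ associatedPrimes S (S ⧸ I), w ∉ P) :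
    NZ I w := by
  intro a ha
  by_contra hn
  have h2 : w ∈ ⋃ p ∈ associatedPrimes S (S ⧸ I), (p : Set S) := by
    rw [biUnion_associatedPrimes_eq_zero_divisors]
    refine ⟨Ideal.Quotient.mk I a, ?_, ?_⟩
    · rwa [Ne, Ideal.Quotient.eq_zero_iff_mem]
    · have : w • (Ideal.Quotient.mk I a) = Ideal.Quotient.mk I (w * a) := rfl
      rw [this, Ideal.Quotient.eq_zero_iff_mem]; exact ha
  simp only [Set.mem_iUnion] at h2
  obtain ⟨P, hP, hw⟩ := h2
  exact h P hP hw

theorem c1 {w a : S} (hw : ∀ b, (X 2 : S) ∣ w * b → (X 2 : S) ∣ b)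
    (hx : X 0 * a ∈ Ideal.span {X 2, w}) (hy : X 1 * a ∈ Ideal.span {X 2, w}) :
    a ∈ Ideal.span {X 2, w} := by
  rw [Ideal.mem_span_pair] at *
  obtain ⟨b, c, h1⟩ := hx
  obtain ⟨b', c', h2⟩ := hy
  obtain ⟨d, ⟨e, he⟩, -⟩ := xy_reg (c := c) (c' := c') (hw _ ⟨b' * X 0 - b * X 1, by
    linear_combination X 1 * h1 - X 0 * h2⟩)
  have h3 : (X 2 : S) ∣ X 0 * (a - w * d) := ⟨b + e * w, by
    linear_combination - h1 + w * he⟩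
  rcases (X_prime (R := ℝ) (i := (2 : Fin 3))).dvd_or_dvd h3 with h4 | ⟨g, hg⟩
  · rw [X_dvd_X] at h4
    simp at h4
  · exact ⟨g, d, by linear_combination - hg⟩

theorem c1' {w a : S} (hw : w ≠ 0)
    (hx : X 0 * a ∈ Ideal.span {w}) (hy : X 1 * a ∈ Ideal.span {w}) :
    a ∈ Ideal.span {w} := by
  rw [Ideal.mem_span_singleton] at *
  obtain ⟨c, h1⟩ := hx
  obtain ⟨c', h2⟩ := hy
  obtain ⟨d, hd, -⟩ := xy_reg0 (c := c) (c' := c') (mul_left_cancel₀ hw (by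
    linear_combination X 0 * h2 - X 1 * h1))
  refine ⟨d, mul_left_cancel₀ (X_ne_zero (0 : Fin 3)) (?_ : X 0 * a = X 0 * (w * d))⟩
  rw [h1, hd]; ring

/-- The data of a regular sequence of cubics. -/
structure Reg (w1 w2 w3 : S) : Prop where
  h1 : ∀ b, (X 2 : S) ∣ w1 * b → (X 2 : S) ∣ b
  h2 : NZ (Ideal.span {X 2, w1}) w2
  h12 : NZ (Ideal.span {w1}) w2
  h3 : NZ (Ideal.span {w1, w2}) w3
  ne : w1 ≠ 0

theorem z_nz {w1 w2 : S} (h1 : ∀ b, (X 2 : S) ∣ w1 * b → (X 2 : S) ∣ b)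
    (h2 : NZ (Ideal.span {X 2, w1}) w2) : NZ (Ideal.span {w1, w2}) (X 2) := by
  intro a ha
  rw [Ideal.mem_span_pair] at ha
  obtain ⟨b, c, h⟩ := ha
  have := h2 c (by
    rw [Ideal.mem_span_pair]
    exact ⟨a, -b, by linear_combination - h⟩)
  rw [Ideal.mem_span_pair] at this
  obtain ⟨c', e, hc⟩ := this
  obtain ⟨b', hb'⟩ := h1 (b + e * w2) ⟨a - c' * w2, by linear_combination h + w2 * hc⟩
  rw [Ideal.mem_span_pair]
  refine ⟨b', c', mul_left_cancel₀ (X_ne_zero (2 : Fin 3) : (X 2 : S) ≠ 0) ?_⟩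
  linear_combination h - w1 * hb' + w2 * hc

theorem exists_reg (W : Submodule ℝ S)
    (hW : ∀ P : Ideal S, P.IsPrime → (∀ w ∈ W, w ∈ P) → ∀ j, X j ∈ P) :
    ∃ w1 ∈ W, ∃ w2 ∈ W, ∃ w3 ∈ W, Reg w1 w2 w3 := by
  have hz : Prime (X 2 : S) := X_prime
  obtain ⟨w1, hw1, hn1⟩ : ∃ w ∈ W, w ∉ Ideal.span {(X 2 : S)} := by
    by_contra hcon
    push Not at hcon
    have := hW _ ((Ideal.span_singleton_prime hz.ne_zero).2 hz) hcon 0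
    rw [Ideal.mem_span_singleton, X_dvd_X] at this
    simp at this
  rw [Ideal.mem_span_singleton] at hn1
  have h1 : ∀ b, (X 2 : S) ∣ w1 * b → (X 2 : S) ∣ b := fun b hb =>
    (hz.dvd_or_dvd hb).resolve_left hn1
  have hne : w1 ≠ 0 := by rintro rfl; exact hn1 (dvd_zero _)
  obtain ⟨w2, hw2, hn2⟩ := avoid W
    (associatedPrimes S (S ⧸ Ideal.span {X 2, w1}) ∪ associatedPrimes S (S ⧸ Ideal.span {w1}))
    ((associatedPrimes.finite _ _).union (associatedPrimes.finite _ _)) (by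
      rintro P (hP | hP)
      · exact assoc_no W hW _ (fun a ha => c1 h1 (ha 0) (ha 1)) P hP
      · exact assoc_no W hW _ (fun a ha => c1' hne (ha 0) (ha 1)) P hP)
  have h2 := nz_of_avoid (Ideal.span {X 2, w1}) w2 fun P hP => hn2 P (Or.inl hP)
  obtain ⟨w3, hw3, hn3⟩ := avoid W (associatedPrimes S (S ⧸ Ideal.span {w1, w2}))
    (associatedPrimes.finite _ _) (assoc_no W hW _ fun a ha => z_nz h1 h2 a (ha 2))
  exact ⟨w1, hw1, w2, hw2, w3, hw3, h1, h2,
    nz_of_avoid (Ideal.span {w1}) w2 fun P hP => hn2 P (Or.inr hP),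
    nz_of_avoid _ w3 hn3, hne⟩

/-- membership in the ideal of three elements -/
def I3 (p q r a : S) : Prop := ∃ b c d, a = p * b + q * c + r * d

theorem socle {w1 w2 w3 : S} (hR : Reg w1 w2 w3) (e1 : w1.IsHomogeneous 3)
    (e2 : w2.IsHomogeneous 3) (e3 : w3.IsHomogeneous 3) {k : ℕ} (hk : k ≤ 2) {a : S}
    (ha : a.IsHomogeneous (k + 3)) (hI : ∀ j, I3 w1 w2 w3 (X j * a)) : I3 w1 w2 w3 a := by
  have zz := z_nz hR.h1 hR.h2
  obtain ⟨α, β, u0, hu0⟩ := hI 2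
  have hz4 : (X 2 * a : S).IsHomogeneous (k + 4) := by
    have := (isHomogeneous_X ℝ (2 : Fin 3)).mul ha
    rwa [show 1 + (k + 3) = k + 4 by ring] at this
  obtain ⟨α, β, u, hu, huh⟩ : ∃ α β u, X 2 * a = w1 * α + w2 * β + w3 * u ∧
      u.IsHomogeneous (k + 1) := by
    refine ⟨homogeneousComponent (k + 1) α, homogeneousComponent (k + 1) β,
      homogeneousComponent (k + 1) u0, ?_, homogeneousComponent_isHomogeneous _ _⟩
    have := congrArg (homogeneousComponent (k + 4)) hu0
    rw [hc_self hz4, map_add, map_add, hc_mul e1, hc_mul e2, hc_mul e3] at this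
    simpa using this
  -- `X j * u` lies in the ideal `(X 2, w1, w2)`
  have key : ∀ j, ∃ s : S, s.IsHomogeneous (k + 2 - 3) ∧
      X j * u - w2 * s ∈ Ideal.span {X 2, w1} := by
    intro j
    obtain ⟨α', β', v, hv⟩ := hI j
    have h := hR.h3 (X j * u - X 2 * v) (by
      rw [Ideal.mem_span_pair]
      exact ⟨X 2 * α' - X j * α, X 2 * β' - X j * β, by
        linear_combination - X 2 * hv + X j * hu⟩)
    rw [Ideal.mem_span_pair] at h
    obtain ⟨b, c, hbc⟩ := h
    have hju : (X j * u : S).IsHomogeneous (k + 2) := by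
      have := (isHomogeneous_X ℝ j).mul huh
      rwa [show 1 + (k + 1) = k + 2 by ring] at this
    have h2 : X j * u = X 2 * v + w1 * b + w2 * c := by linear_combination - hbc
    have h3 := congrArg (homogeneousComponent (k + 2)) h2
    rw [hc_self hju, map_add, map_add, hc_mul e1, hc_mul e2, hc_mul (isHomogeneous_X ℝ 2)] at h3
    by_cases hk3 : 3 ≤ k + 2
    · refine ⟨homogeneousComponent (k + 2 - 3) c, homogeneousComponent_isHomogeneous _ _, ?_⟩
      rw [Ideal.mem_span_pair]
      refine ⟨homogeneousComponent (k + 2 - 1) v, homogeneousComponent (k + 2 - 3) b, ?_⟩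
      rw [if_pos (by omega), if_pos hk3, if_pos hk3] at h3
      rw [h3]; ring
    · refine ⟨0, isHomogeneous_zero _ _ _, ?_⟩
      rw [Ideal.mem_span_pair]
      refine ⟨homogeneousComponent (k + 2 - 1) v, 0, ?_⟩
      rw [if_pos (by omega), if_neg hk3, if_neg hk3] at h3
      rw [h3]; ring
  obtain ⟨s, hs, hs'⟩ := key 0
  obtain ⟨t, ht, ht'⟩ := key 1
  have hst := hR.h2 (X 1 * s - X 0 * t) (by
    have h1 := Ideal.mul_mem_left _ (X 1) hs'
    have h2 := Ideal.mul_mem_left _ (X 0) ht'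
    have := sub_mem h2 h1
    convert this using 1; ring)
  rw [Ideal.mem_span_pair] at hst
  obtain ⟨g, g', hg⟩ := hst
  have hdeg : (X 1 * s - X 0 * t : S).IsHomogeneous (1 + (k + 2 - 3)) :=
    ((isHomogeneous_X ℝ 1).mul hs).sub ((isHomogeneous_X ℝ 0).mul ht)
  have hdiv : (X 2 : S) ∣ X 1 * s - X 0 * t := by
    have h3 := congrArg (homogeneousComponent (1 + (k + 2 - 3))) hg
    rw [hc_self hdeg, map_add, mul_comm g, mul_comm g', hc_mul e1, hc_mul (isHomogeneous_X ℝ 2),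
      if_pos (by omega), if_neg (by omega), add_zero] at h3
    exact ⟨_, h3.symm⟩
  obtain ⟨c, ⟨m, hm⟩, ⟨m', hm'⟩⟩ := xy_reg hdiv
  have hu' : u - w2 * c ∈ Ideal.span {X 2, w1} := by
    have hx2 : (X 2 : S) ∈ Ideal.span {X 2, w1} := Ideal.subset_span (by simp)
    apply c1 hR.h1
    · have := add_mem hs' (Ideal.mul_mem_left _ (w2 * m) hx2)
      convert this using 1
      linear_combination w2 * hm
    · have := add_mem ht' (Ideal.mul_mem_left _ (w2 * m') hx2)
      convert this using 1
      linear_combination w2 * hm'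
  rw [Ideal.mem_span_pair] at hu'
  obtain ⟨u', y, hy⟩ := hu'
  have := zz (a - u' * w3) (by
    rw [Ideal.mem_span_pair]
    exact ⟨α + y * w3, β + c * w3, by linear_combination - hu + w3 * hy⟩)
  rw [Ideal.mem_span_pair] at this
  obtain ⟨b, d, hbd⟩ := this
  exact ⟨b, d, u', by linear_combination - hbd⟩

/-- Forms of degree `n`. -/
abbrev H (n : ℕ) := homogeneousSubmodule (Fin 3) ℝ n

theorem card_deg (n : ℕ) : Nat.card {d : Fin 3 →₀ ℕ | d.degree = n} = (n + 2).choose 2 := by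
  have h1 : {d : Fin 3 →₀ ℕ | d.degree = n} =
      (Finset.finsuppAntidiag (Finset.univ : Finset (Fin 3)) n : Set (Fin 3 →₀ ℕ)) := by
    ext d
    simp [Finset.mem_finsuppAntidiag, Finsupp.degree_eq_sum]
  rw [h1]
  simp only [SetLike.coe_sort_coe, Nat.card_eq_fintype_card, Fintype.card_coe,
    Finset.card_finsuppAntidiag_nat_eq_choose, Finset.card_univ, Fintype.card_fin]
  rw [show 3 + n - 1 = n + 2 by omega, Nat.choose_symm_add]

theorem finrank_H (n : ℕ) : Module.finrank ℝ (H n) = (n + 2).choose 2 := by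
  have : H n = restrictSupport ℝ {d : Fin 3 →₀ ℕ | d.degree = n} :=
    homogeneousSubmodule_eq_finsupp_supported _ _ n
  rw [this, ← card_deg n]
  exact Module.finrank_eq_nat_card_basis (basisRestrictSupport ℝ _)

instance (n : ℕ) : FiniteDimensional ℝ (H n) := by
  apply Module.finite_of_finrank_pos
  rw [finrank_H]
  exact Nat.choose_pos (by omega)

/-- Multiplication of forms. -/
def mulH (a b : ℕ) : H a →ₗ[ℝ] H b →ₗ[ℝ] H (a + b) :=
  LinearMap.mk₂ ℝ (fun p q => ⟨(p : S) * q, p.2.mul q.2⟩)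
    (fun _ _ _ => Subtype.ext (add_mul _ _ _))
    (fun _ _ _ => Subtype.ext (smul_mul_assoc _ _ _))
    (fun _ _ _ => Subtype.ext (mul_add _ _ _))
    (fun _ _ _ => Subtype.ext (mul_smul_comm _ _ _))

/-- Product of two cubics. -/
def B : H 3 →ₗ[ℝ] H 3 →ₗ[ℝ] H 6 := mulH 3 3

theorem B_coe (p q : H 3) : (B p q : S) = p * q := rfl

theorem B_symm (p q : H 3) : B p q = B q p := Subtype.ext (mul_comm _ _)

/-- The differential of the sum of squares map (up to a factor 2). -/
def D (p : Fin 4 → H 3) : (Fin 4 → H 3) →ₗ[ℝ] H 6 :=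
  ∑ i, (B (p i)).comp (LinearMap.proj i)

theorem D_apply (p q : Fin 4 → H 3) : D p q = ∑ i, B (p i) (q i) := by
  simp [D]

def M3 (w : Fin 3 → H 3) : (Fin 3 → H 3) →ₗ[ℝ] H 6 :=
  ∑ i, (B (w i)).comp (LinearMap.proj i)

theorem M3_apply (p q : Fin 3 → H 3) : M3 p q = B (p 0) (q 0) + B (p 1) (q 1) + B (p 2) (q 2) := by
  simp [M3, Fin.sum_univ_three]

def K3 (w : Fin 3 → H 3) : (Fin 3 → ℝ) →ₗ[ℝ] (Fin 3 → H 3) where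
  toFun c := ![c 2 • w 1 - c 0 • w 2, - c 1 • w 2 - c 2 • w 0, c 0 • w 0 + c 1 • w 1]
  map_add' c d := by
    ext i : 1
    fin_cases i <;> simp <;> module
  map_smul' c d := by
    ext i : 1
    fin_cases i <;> simp [mul_smul] <;> module

theorem hom_cst {w1 w2 a : S} (e1 : w1.IsHomogeneous 3) (e2 : w2.IsHomogeneous 3)
    (ha : a.IsHomogeneous 3) (h : a ∈ Ideal.span {w1, w2}) :
    ∃ c d : ℝ, a = w1 * C c + w2 * C d := by
  rw [Ideal.mem_span_pair] at h
  obtain ⟨b, b', h⟩ := h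
  have h3 := congrArg (homogeneousComponent 3) h
  rw [hc_self ha, map_add, mul_comm b, mul_comm b', hc_mul e1, hc_mul e2] at h3
  simp only [le_refl, if_true, Nat.sub_self, homogeneousComponent_zero] at h3
  exact ⟨_, _, h3.symm⟩

theorem ker_M3 {w : Fin 3 → H 3} (hR : Reg (w 0) (w 1) (w 2)) :
    LinearMap.ker (M3 w) ≤ LinearMap.range (K3 w) := by
  intro a ha
  rw [LinearMap.mem_ker, M3_apply] at ha
  have ha' : (w 0 : S) * (a 0 : S) + w 1 * (a 1 : S) + w 2 * (a 2 : S) = 0 :=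
    congrArg Subtype.val ha
  have h3 := hR.h3 (a 2) (by
    rw [Ideal.mem_span_pair]
    exact ⟨- a 0, - a 1, by linear_combination - ha'⟩)
  obtain ⟨c, d, hcd⟩ := hom_cst (w 0).2 (w 1).2 (a 2).2 h3
  have h2 := hR.h12 ((a 1 : S) + (w 2 : S) * C d) (by
    rw [Ideal.mem_span_singleton]
    exact ⟨-((a 0 : S) + (w 2 : S) * C c), by linear_combination ha' - (w 2 : S) * hcd⟩)
  have hh : ((a 1 : S) + (w 2 : S) * C d).IsHomogeneous 3 := by
    have := (w 2).2.mul (isHomogeneous_C (Fin 3) d)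
    exact IsHomogeneous.add (a 1).2 this
  obtain ⟨e, e', he⟩ := hom_cst (w 0).2 (w 0).2 hh (by simpa using h2)
  have h1 : (a 0 : S) = - (w 2 : S) * C c - (w 1 : S) * (C e + C e') := by
    apply mul_left_cancel₀ hR.ne
    linear_combination ha' - (w 2 : S) * hcd - (w 1 : S) * he
  refine ⟨![c, d, -(e + e')], ?_⟩
  ext i : 2
  fin_cases i
  · simp [K3, smul_eq_C_mul, h1]; ring
  · have : (a 1 : S) = (w 0 : S) * C e + (w 0 : S) * C e' - (w 2 : S) * C d := by linear_combination he
    simp [K3, smul_eq_C_mul, this]; ring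
  · simp [K3, smul_eq_C_mul, hcd]; ring

theorem rank_M3 {w : Fin 3 → H 3} (hR : Reg (w 0) (w 1) (w 2)) :
    27 ≤ Module.finrank ℝ (LinearMap.range (M3 w)) := by
  have h1 := LinearMap.finrank_range_add_finrank_ker (M3 w)
  have h2 := Submodule.finrank_mono (ker_M3 hR)
  have h3 := LinearMap.finrank_range_le (K3 w)
  rw [Module.finrank_fintype_fun_eq_card] at h3
  rw [Module.finrank_pi_fintype] at h1
  simp only [finrank_H, Finset.sum_const, Finset.card_univ, Fintype.card_fin] at h1 h3
  norm_num [Nat.choose] at h1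
  omega

/-- Every prime containing the forms `p i` contains the irrelevant ideal. -/
def NoZero (p : Fin 4 → H 3) : Prop :=
  ∀ P : Ideal S, P.IsPrime → (∀ i, (p i : S) ∈ P) → ∀ j, X j ∈ P

theorem exists_M3 {p : Fin 4 → H 3} (hp : NoZero p) :
    ∃ w : Fin 3 → H 3, Reg (w 0) (w 1) (w 2) ∧ (∀ i, w i ∈ Submodule.span ℝ (Set.range p)) := by
  obtain ⟨w1, hw1, w2, hw2, w3, hw3, hR⟩ := exists_reg
    ((Submodule.span ℝ (Set.range p)).map (Submodule.subtype _)) (fun P hP h => hp P hP fun i =>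
      h _ ⟨p i, Submodule.subset_span ⟨i, rfl⟩, rfl⟩)
  obtain ⟨v1, hv1, rfl⟩ := hw1
  obtain ⟨v2, hv2, rfl⟩ := hw2
  obtain ⟨v3, hv3, rfl⟩ := hw3
  refine ⟨![v1, v2, v3], hR, ?_⟩
  intro i
  fin_cases i <;> assumption

theorem span_D {p : Fin 4 → H 3} {w : H 3} (hw : w ∈ Submodule.span ℝ (Set.range p)) (a : H 3) :
    B w a ∈ LinearMap.range (D p) := by
  induction hw using Submodule.span_induction with
  | mem x hx =>
    obtain ⟨i, rfl⟩ := hx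
    refine ⟨Pi.single i a, ?_⟩
    rw [D_apply, Finset.sum_eq_single i]
    · simp
    · intro j _ hj
      simp [hj]
    · simp
  | zero => simp
  | add x y _ _ hx hy => rw [map_add, LinearMap.add_apply]; exact add_mem hx hy
  | smul c x _ hx => rw [map_smul, LinearMap.smul_apply]; exact Submodule.smul_mem _ _ hx

theorem M3_le {p : Fin 4 → H 3} {w : Fin 3 → H 3}
    (hw : ∀ i, w i ∈ Submodule.span ℝ (Set.range p)) :
    LinearMap.range (M3 w) ≤ LinearMap.range (D p) := by
  rintro _ ⟨a, rfl⟩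
  rw [M3_apply]
  exact add_mem (add_mem (span_D (hw 0) _) (span_D (hw 1) _)) (span_D (hw 2) _)

theorem alg1 {p : Fin 4 → H 3} (hp : NoZero p) :
    27 ≤ Module.finrank ℝ (LinearMap.range (D p)) := by
  obtain ⟨w, hR, hw⟩ := exists_M3 hp
  exact (rank_M3 hR).trans (Submodule.finrank_mono (M3_le hw))

theorem alg2 {p : Fin 4 → H 3} (hp : NoZero p) (hli : LinearIndependent ℝ p) :
    LinearMap.range (D p) = ⊤ := by
  obtain ⟨w, hR, hw⟩ := exists_M3 hp
  by_contra hne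
  have hlt := Submodule.finrank_lt hne
  rw [finrank_H] at hlt
  norm_num [Nat.choose] at hlt
  have hr := rank_M3 hR
  have heq : LinearMap.range (M3 w) = LinearMap.range (D p) :=
    Submodule.eq_of_le_of_finrank_le (M3_le hw) (by omega)
  -- every element of the span lies in the span of `w`
  have hsub : Submodule.span ℝ (Set.range p) ≤ Submodule.span ℝ (Set.range w) := by
    intro v hv
    have h0 : ∀ a : H 3, I3 (w 0) (w 1) (w 2) (a * v) := by
      intro a
      have h := span_D hv a
      rw [← heq] at h
      obtain ⟨q, hq⟩ := h
      rw [M3_apply] at hq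
      have hq' : (w 0 : S) * (q 0 : S) + w 1 * (q 1 : S) + w 2 * (q 2 : S) = v * a :=
        congrArg Subtype.val hq
      exact ⟨_, _, _, by rw [hq']; ring⟩
    have X1 := fun j => isHomogeneous_X ℝ (j : Fin 3)
    have hv3 : (v : S).IsHomogeneous 3 := v.2
    have s2 : ∀ i j, I3 (w 0) (w 1) (w 2) (X i * (X j * (v : S))) := fun i j =>
      socle hR (w 0).2 (w 1).2 (w 2).2 (k := 2) le_rfl (((X1 i).mul ((X1 j).mul hv3))) fun l => by
        have := h0 ⟨X l * X i * X j, ((X1 l).mul (X1 i)).mul (X1 j)⟩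
        convert this using 1
        simp only; ring
    have s1 : ∀ i, I3 (w 0) (w 1) (w 2) (X i * (v : S)) := fun i =>
      socle hR (w 0).2 (w 1).2 (w 2).2 (k := 1) (by norm_num) ((X1 i).mul hv3) fun l => s2 l i
    obtain ⟨b, c, d, hb⟩ := socle hR (w 0).2 (w 1).2 (w 2).2 (k := 0) (by norm_num) hv3 s1
    have h3 := congrArg (homogeneousComponent 3) hb
    rw [hc_self hv3, map_add, map_add, hc_mul (w 0).2, hc_mul (w 1).2, hc_mul (w 2).2] at h3
    simp only [le_refl, if_true, Nat.sub_self, homogeneousComponent_zero] at h3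
    have : v = coeff 0 b • w 0 + coeff 0 c • w 1 + coeff 0 d • w 2 := by
      apply Subtype.ext
      rw [h3]
      simp [smul_eq_C_mul]; ring
    rw [this]
    have hm : ∀ i, w i ∈ Submodule.span ℝ (Set.range w) := fun i => Submodule.subset_span ⟨i, rfl⟩
    exact add_mem (add_mem (Submodule.smul_mem _ _ (hm 0)) (Submodule.smul_mem _ _ (hm 1)))
      (Submodule.smul_mem _ _ (hm 2))
  have h1 := Submodule.finrank_mono hsub
  have h2 := finrank_range_le_card (R := ℝ) w
  rw [finrank_span_eq_card hli] at h1
  simp [Set.finrank] at h1 h2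
  omega

section Analysis
set_option linter.unusedSectionVars false
open Topology Filter

variable {E F : Type*} [NormedAddCommGroup E] [NormedSpace ℝ E] [FiniteDimensional ℝ E]
  [NormedAddCommGroup F] [NormedSpace ℝ F] [FiniteDimensional ℝ F]

theorem fderiv_poly {X Y : Type*} [NormedAddCommGroup X] [NormedSpace ℝ X]
    [NormedAddCommGroup Y] [NormedSpace ℝ Y] {G : X → Y} (hG : ContDiff ℝ 1 G) {x v : X} {a b c : Y}
    (h : ∀ t : ℝ, G (x + t • v) = a + t • b + t ^ 2 • c) : fderiv ℝ G x v = b := by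
  have h1 := ((hG.differentiable (by norm_num)) x).hasFDerivAt.hasLineDerivAt v
  unfold HasLineDerivAt at h1
  simp only [h] at h1
  have h2 : HasDerivAt (fun t : ℝ => a + t • b + t ^ 2 • c) b 0 := by
    have e1 := ((hasDerivAt_id (0 : ℝ)).smul_const b).const_add a
    have e2 := ((hasDerivAt_id (0 : ℝ)).pow 2).smul_const c
    have e3 := e1.add e2
    refine (e3.congr_deriv ?_).congr_of_eventuallyEq (Eventually.of_forall fun t => ?_) <;> simp
  exact h1.unique h2

/-- The sum of four squares map. -/
def SQ (B : E →L[ℝ] E →L[ℝ] F) (p : Fin 4 → E) : F := ∑ i, B (p i) (p i)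

/-- Sums of squares. -/
def Sig (B : E →L[ℝ] E →L[ℝ] F) : Set F :=
  (AddSubmonoid.closure (Set.range fun q => B q q) : Set F)

variable {B : E →L[ℝ] E →L[ℝ] F}

theorem SQ_contDiff : ContDiff ℝ 1 (SQ B) := by
  unfold SQ
  fun_prop

theorem SQ_mem (p : Fin 4 → E) : SQ B p ∈ Sig B :=
  sum_mem fun i _ => AddSubmonoid.subset_closure ⟨p i, rfl⟩

theorem Sig_smul {t : ℝ} (ht : 0 ≤ t) {f : F} (hf : f ∈ Sig B) : t • f ∈ Sig B := by
  unfold Sig at hf ⊢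
  induction hf using AddSubmonoid.closure_induction with
  | mem x hx =>
    obtain ⟨q, rfl⟩ := hx
    refine AddSubmonoid.subset_closure ⟨Real.sqrt t • q, ?_⟩
    simp [smul_smul, Real.mul_self_sqrt ht]
  | zero => simp
  | add x y _ _ hx hy => rw [smul_add]; exact add_mem hx hy

theorem Sig_add {f g : F} (hf : f ∈ Sig B) (hg : g ∈ Sig B) : f + g ∈ Sig B :=
  add_mem (S := AddSubmonoid F) hf hg

theorem Sig_convex : Convex ℝ (Sig B) := fun _ hx _ hy _ _ ha hb _ =>
  Sig_add (Sig_smul ha hx) (Sig_smul hb hy)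

theorem Sig_int {f : F} (hf : f ∈ interior (Sig B)) (L : F →L[ℝ] ℝ) (hL : L ≠ 0)
    (hpos : ∀ q, 0 ≤ L (B q q)) : L f ≠ 0 := by
  intro h0
  have hS : ∀ g ∈ Sig B, 0 ≤ L g := by
    intro g hg
    unfold Sig at hg
    induction hg using AddSubmonoid.closure_induction with
    | mem x hx => obtain ⟨q, rfl⟩ := hx; exact hpos q
    | zero => simp
    | add x y _ _ hx hy => rw [map_add]; exact add_nonneg hx hy
  obtain ⟨h, hh⟩ : ∃ h, L h ≠ 0 := by
    by_contra! hc
    exact hL (ContinuousLinearMap.ext hc)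
  have hev : ∀ᶠ t : ℝ in 𝓝 0, f - (t * L h) • h ∈ Sig B := by
    have hc : Tendsto (fun t : ℝ => f - (t * L h) • h) (𝓝 0) (𝓝 f) := by
      have : Continuous (fun t : ℝ => f - (t * L h) • h) := by fun_prop
      simpa using this.tendsto 0
    exact hc (mem_interior_iff_mem_nhds.1 hf)
  obtain ⟨δ, hδ, hball⟩ := Metric.eventually_nhds_iff.1 hev
  have := hS _ (hball (y := δ / 2) (by simp [abs_of_pos hδ, hδ]))
  simp only [map_sub, h0, map_smul, smul_eq_mul] at this
  have : 0 < L h * L h := mul_self_pos.2 hh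
  nlinarith [this]

theorem SQ_smul (t : ℝ) (p : Fin 4 → E) : SQ B (t • p) = t ^ 2 • SQ B p := by
  simp [SQ, Finset.smul_sum, smul_smul, sq]

theorem closed_S4 (hdef : ∀ p, SQ B p = 0 → p = 0) : IsClosed (Set.range (SQ B)) := by
  have hcont : Continuous (SQ B) := SQ_contDiff.continuous
  obtain ⟨c, hc, hcb⟩ := (isCompact_sphere (0 : Fin 4 → E) 1).exists_forall_le'
    (f := fun p => ‖SQ B p‖) hcont.norm.continuousOn (a := 0) (by
      intro b hb
      rw [norm_pos_iff]
      intro h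
      have := hdef b h
      simp [this] at hb)
  have hb : ∀ p, c * ‖p‖ ^ 2 ≤ ‖SQ B p‖ := by
    intro p
    by_cases hp : p = 0
    · simp [hp]
    have hn : 0 < ‖p‖ := norm_pos_iff.2 hp
    have h1 := hcb (‖p‖⁻¹ • p) (by simp [norm_smul, hn.ne'])
    rw [SQ_smul, norm_smul] at h1
    simp only [inv_pow, norm_inv, norm_pow, norm_norm] at h1
    rw [inv_mul_eq_div, le_div_iff₀ (by positivity)] at h1
    exact h1
  have ht : Tendsto (SQ B) (cocompact _) (cocompact _) := by
    rw [← Metric.cobounded_eq_cocompact (α := F), ← tendsto_norm_atTop_iff_cobounded]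
    refine tendsto_atTop_mono hb ?_
    exact ((tendsto_pow_atTop (by norm_num)).comp tendsto_norm_cocompact_atTop).const_mul_atTop hc
  exact (isProperMap_iff_tendsto_cocompact.2 ⟨hcont, ht⟩).isClosedMap.isClosed_range

theorem nhds_surj (hs : ∀ p q, B p q = B q p) {p : Fin 4 → E}
    (h : ∀ f, ∃ q : Fin 4 → E, ∑ i, B (p i) (q i) = f) : Set.range (SQ B) ∈ 𝓝 (SQ B p) := by
  have h1 : HasStrictFDerivAt (SQ B) (fderiv ℝ (SQ B) p) p :=
    (SQ_contDiff (B := B)).contDiffAt.hasStrictFDerivAt (by norm_num)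
  have h2 : ∀ q, fderiv ℝ (SQ B) p q = (2 : ℝ) • ∑ i, B (p i) (q i) := by
    intro q
    refine fderiv_poly SQ_contDiff (a := SQ B p) (c := SQ B q) fun t => ?_
    simp only [SQ, Fin.sum_univ_four, Pi.add_apply, Pi.smul_apply, map_add, map_smul,
      add_apply, smul_apply]
    simp only [fun i => hs (q i) (p i)]
    module
  rw [← h1.map_nhds_eq_of_surj]
  · rw [mem_map]
    exact univ_mem' fun x => ⟨x, rfl⟩
  · rw [LinearMap.range_eq_top]
    intro f
    obtain ⟨q, hq⟩ := h ((2 : ℝ)⁻¹ • f)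
    refine ⟨q, ?_⟩
    rw [ContinuousLinearMap.coe_coe, h2, hq, smul_smul]
    norm_num

/-- Second-order perturbation. -/
def Psi (B : E →L[ℝ] E →L[ℝ] F) (p : Fin 4 → E) (c : Fin 4 → ℝ) (x : ℝ × (Fin 4 → E) × E) :
    ℝ × F :=
  (x.1, (2 : ℝ) • (∑ i, B (p i) (x.2.1 i)) + B x.2.2 x.2.2 +
    (2 * x.1) • (∑ i, c i • B x.2.2 (x.2.1 i)) + x.1 ^ 2 • ∑ i, B (x.2.1 i) (x.2.1 i))

theorem Psi_contDiff (p : Fin 4 → E) (c : Fin 4 → ℝ) : ContDiff ℝ 1 (Psi B p c) := by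
  unfold Psi
  fun_prop

theorem Psi_eq (hs : ∀ p q, B p q = B q p) {p : Fin 4 → E} {c : Fin 4 → ℝ} (hc : ∑ i, c i ^ 2 = 1)
    (hcp : ∑ i, c i • p i = 0) (e : ℝ) (r : Fin 4 → E) (q : E) :
    SQ B (fun i => p i + e ^ 2 • r i + (e * c i) • q) = SQ B p + e ^ 2 • (Psi B p c (e, r, q)).2 := by
  have h1 : B (∑ i, c i • p i) q = 0 := by rw [hcp]; simp
  have h2 : c 0 ^ 2 = 1 - c 1 ^ 2 - c 2 ^ 2 - c 3 ^ 2 := by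
    rw [Fin.sum_univ_four] at hc; linarith
  have h3 : c 0 • B (p 0) q = - c 1 • B (p 1) q - c 2 • B (p 2) q - c 3 • B (p 3) q := by
    simp only [Fin.sum_univ_four, map_add, map_smul, add_apply,
      smul_apply] at h1
    linear_combination (norm := module) h1
  simp only [SQ, Psi, Fin.sum_univ_four, map_add, map_smul,
      add_apply, smul_apply]
  simp only [fun i => hs (r i) (p i), fun i => hs q (p i), fun i => hs (r i) q]
  linear_combination (norm := module) (2 * e) • h3 + h2 • (e ^ 2 • B q q)

theorem nhds_corank (hs : ∀ p q, B p q = B q p) {p : Fin 4 → E} {c : Fin 4 → ℝ}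
    (hc : ∑ i, c i ^ 2 = 1) (hcp : ∑ i, c i • p i = 0) (L : F →L[ℝ] ℝ)
    (hLr : ∀ q : Fin 4 → E, L (∑ i, B (p i) (q i)) = 0)
    (hLs : ∀ f, L f = 0 → ∃ q : Fin 4 → E, ∑ i, B (p i) (q i) = f)
    {a b : E} (ha : 0 < L (B a a)) (hb : L (B b b) < 0) :
    Set.range (SQ B) ∈ 𝓝 (SQ B p) := by
  -- the isotropic vector
  obtain ⟨q0, hq0, hq1⟩ : ∃ q0, L (B q0 q0) = 0 ∧ L (B q0 b) ≠ 0 := by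
    set A := L (B a a) with hA
    set C := L (B b b) with hC
    set D := L (B a b) with hD
    have hpos : 0 < D ^ 2 - A * C := by nlinarith [mul_pos ha (neg_pos.2 hb), sq_nonneg D]
    have hsq := Real.sq_sqrt hpos.le
    have hsp := Real.sqrt_pos.2 hpos
    set s := Real.sqrt (D ^ 2 - A * C)
    refine ⟨a + ((s - D) / C) • b, ?_, ?_⟩
    · simp only [map_add, map_smul, add_apply, smul_apply,
        smul_eq_mul, hs b a, ← hA, ← hC, ← hD]
      have := hb.ne
      field_simp
      linear_combination hsq
    · simp only [map_add, map_smul, add_apply, smul_apply,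
        smul_eq_mul, ← hA, ← hC, ← hD]
      have := hb.ne
      have : D + (s - D) / C * C = s := by field_simp; ring
      rw [this]; exact hsp.ne'
  obtain ⟨r0, hr0⟩ := hLs (-(2 : ℝ)⁻¹ • B q0 q0) (by simp [hq0])
  set x0 : ℝ × (Fin 4 → E) × E := (0, r0, q0) with hx0
  have hP := Psi_contDiff (B := B) p c
  have h1 : HasStrictFDerivAt (Psi B p c) (fderiv ℝ (Psi B p c) x0) x0 :=
    hP.contDiffAt.hasStrictFDerivAt (by norm_num)
  have hval : Psi B p c x0 = 0 := by
    simp only [Psi, hx0, hr0]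
    ext <;> simp [smul_smul]
  have hd2 : ∀ r q, fderiv ℝ (Psi B p c) x0 (0, r, q) =
      (0, (2 : ℝ) • (∑ i, B (p i) (r i)) + (2 : ℝ) • B q0 q) := by
    intro r q
    refine fderiv_poly hP (a := Psi B p c x0) (c := (0, B q q)) fun t => ?_
    ext
    · simp [Psi, hx0]
    · simp only [Psi, hx0, Fin.sum_univ_four, Pi.add_apply, Pi.smul_apply, map_add, map_smul,
        add_apply, smul_apply, Prod.snd_add, Prod.fst_add,
        Prod.smul_fst, Prod.smul_snd, hs q q0]
      simp only [smul_zero, add_zero, mul_zero, zero_smul]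
      module
  have hd1 : ∀ e, (fderiv ℝ (Psi B p c) x0 (e, 0, 0)).1 = e := by
    intro e
    have h3 : HasFDerivAt (fun x => (Psi B p c x).1) _ x0 := h1.hasFDerivAt.fst
    have h4 : HasFDerivAt (fun x : ℝ × (Fin 4 → E) × E => x.1)
        (ContinuousLinearMap.fst ℝ ℝ ((Fin 4 → E) × E)) x0 := hasFDerivAt_fst
    have := DFunLike.congr_fun (h3.unique h4) (e, 0, 0)
    simpa using this
  have hsurj : LinearMap.range (fderiv ℝ (Psi B p c) x0).toLinearMap = ⊤ := by
    rw [LinearMap.range_eq_top]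
    rintro ⟨e, f⟩
    set g := (fderiv ℝ (Psi B p c) x0 (e, 0, 0)).2 with hg
    set s := L (f - g) / (2 * L (B q0 b)) with hsdef
    obtain ⟨r, hr⟩ := hLs ((2 : ℝ)⁻¹ • (f - g - (2 * s) • B q0 b)) (by
      rw [map_smul, map_sub, map_smul, hsdef, smul_eq_mul, smul_eq_mul]
      field_simp
      ring)
    refine ⟨(e, 0, 0) + (0, r, s • b), ?_⟩
    rw [ContinuousLinearMap.coe_coe, map_add, hd2, hr]
    ext
    · simp [hd1]
    · simp only [Prod.snd_add, ← hg, map_smul, smul_smul]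
      norm_num
  have hnhds : Set.range (Psi B p c) ∈ 𝓝 (0 : ℝ × F) := by
    rw [← hval, ← h1.map_nhds_eq_of_surj hsurj, mem_map]
    exact univ_mem' fun x => ⟨x, rfl⟩
  obtain ⟨δ, hδ, hball⟩ := Metric.mem_nhds_iff.1 hnhds
  have hδ2 : 0 < δ / 2 := by positivity
  rw [Metric.mem_nhds_iff]
  refine ⟨(δ / 2) ^ 2 * δ, by positivity, fun f hf => ?_⟩
  have hmem : ((δ / 2, ((δ / 2) ^ 2)⁻¹ • (f - SQ B p)) : ℝ × F) ∈ Metric.ball (0 : ℝ × F) δ := by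
    rw [mem_ball_zero_iff, Prod.norm_def, max_lt_iff]
    constructor
    · simp [abs_of_pos hδ, hδ]
    · rw [mem_ball_iff_norm] at hf
      simp only [norm_smul, norm_inv, norm_pow, Real.norm_eq_abs, abs_of_pos hδ2]
      rw [inv_mul_lt_iff₀ (by positivity)]
      exact hf
  obtain ⟨⟨e, r, q⟩, hx⟩ := hball hmem
  have he : e = δ / 2 := congrArg Prod.fst hx
  subst he
  refine ⟨_, (Psi_eq hs hc hcp (δ / 2) r q).trans ?_⟩
  rw [hx, smul_smul, mul_inv_cancel₀ (by positivity), one_smul]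
  abel

theorem main_analysis (hs : ∀ p q, B p q = B q p) (hdef : ∀ p, SQ B p = 0 → p = 0)
    (Z : Set F)
    (hZ : ∀ f1 : F, Dense {f : F | ∃ b ∈ Z, ∃ t : ℝ, f = f1 + t • (b - f1)}ᶜ)
    (hne : ∃ p : Fin 4 → E, ∀ f, ∃ q : Fin 4 → E, ∑ i, B (p i) (q i) = f)
    (key : ∀ p : Fin 4 → E, SQ B p ∉ Z →
      (∀ L : F →L[ℝ] ℝ, L ≠ 0 → (∀ q, 0 ≤ L (B q q)) → L (SQ B p) ≠ 0) →
      (∀ f, ∃ q : Fin 4 → E, ∑ i, B (p i) (q i) = f) ∨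
      ∃ c : Fin 4 → ℝ, ∑ i, c i ^ 2 = 1 ∧ ∑ i, c i • p i = 0 ∧ ∃ L : F →L[ℝ] ℝ, L ≠ 0 ∧
        (∀ q : Fin 4 → E, L (∑ i, B (p i) (q i)) = 0) ∧
        (∀ f, L f = 0 → ∃ q : Fin 4 → E, ∑ i, B (p i) (q i) = f)) :
    Sig B ⊆ Set.range (SQ B) := by
  have hclosed := closed_S4 hdef
  have hsub : Set.range (SQ B) ⊆ Sig B := by rintro _ ⟨p, rfl⟩; exact SQ_mem p
  obtain ⟨p0, hp0⟩ := hne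
  have hf0 := nhds_surj hs hp0
  set f0 := SQ B p0
  have hloc : ∀ f ∈ interior (Sig B), f ∈ Set.range (SQ B) → f ∉ Z → Set.range (SQ B) ∈ 𝓝 f := by
    rintro _ hf ⟨p, rfl⟩ hfZ
    rcases key p hfZ (fun L h1 h2 => Sig_int hf L h1 h2) with h | ⟨c, hc, hcp, L, hL, hLr, hLs⟩
    · exact nhds_surj hs h
    · have hLf : L (SQ B p) = 0 := hLr p
      obtain ⟨b, hb⟩ : ∃ b, L (B b b) < 0 := by
        by_contra! hcon
        exact Sig_int hf L hL hcon hLf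
      obtain ⟨a, ha⟩ : ∃ a, 0 < L (B a a) := by
        by_contra! hcon
        exact Sig_int hf (-L) (neg_ne_zero.2 hL) (fun q => by simpa using hcon q) (by simp [hLf])
      exact nhds_corank hs hc hcp L hLr hLs ha hb
  have hint : ∀ f1 ∈ interior (Sig B), f1 ∈ Set.range (SQ B) := by
    intro f1 hf1
    obtain ⟨f0', hm, hcone⟩ := (hZ f1).inter_nhds_nonempty (interior_mem_nhds.2 hf0)
    have h0S := interior_subset hcone
    have h0I : f0' ∈ interior (Sig B) := interior_mono hsub hcone
    set g : ℝ → F := fun s => f0' + s • (f1 - f0') with hg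
    have hgc : Continuous g := by fun_prop
    have := IsClosed.Icc_subset_of_forall_mem_nhdsWithin (a := (0 : ℝ)) (b := 1)
      (s := g ⁻¹' Set.range (SQ B)) ((hclosed.preimage hgc).inter isClosed_Icc)
      (by simpa [hg] using h0S) (by
        rintro s ⟨hs1, hs2⟩
        refine mem_nhdsWithin_of_mem_nhds (hgc.continuousAt ?_)
        refine hloc _ ?_ hs1 ?_
        · have := Sig_convex.interior h0I hf1 (a := 1 - s) (b := s) (by linarith [hs2.2]) hs2.1 (by ring)
          convert this using 1
          simp only [hg]
          module
        · intro hz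
          apply hm
          have : 1 - s ≠ 0 := by linarith [hs2.2]
          refine ⟨_, hz, (1 - s)⁻¹, ?_⟩
          have h2 : g s - f1 = (1 - s) • (f0' - f1) := by
            simp only [hg]; module
          rw [h2, smul_smul, inv_mul_cancel₀ this, one_smul]
          abel)
    have := this (Set.right_mem_Icc.2 zero_le_one)
    simpa [hg] using this
  intro f1 hf1
  have hlim : Tendsto (fun t : ℝ => f1 + t • f0) (𝓝[>] 0) (𝓝 f1) := by
    have : Continuous (fun t : ℝ => f1 + t • f0) := by fun_prop
    have := this.tendsto 0
    simp only [zero_smul, add_zero] at this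
    exact this.mono_left nhdsWithin_le_nhds
  refine hclosed.mem_of_tendsto hlim ?_
  filter_upwards [self_mem_nhdsWithin] with t ht
  apply hint
  have ht : 0 < t := ht
  rw [mem_interior_iff_mem_nhds]
  have hc : Tendsto (fun f => t⁻¹ • (f - f1)) (𝓝 (f1 + t • f0)) (𝓝 f0) := by
    have : Continuous (fun f : F => t⁻¹ • (f - f1)) := by fun_prop
    have := this.tendsto (f1 + t • f0)
    simpa [smul_smul, ht.ne'] using this
  filter_upwards [hc hf0] with f hf
  have : f = f1 + t • (t⁻¹ • (f - f1)) := by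
    rw [smul_smul, mul_inv_cancel₀ ht.ne', one_smul]; abel
  rw [this]
  exact Sig_add hf1 (Sig_smul ht.le (hsub hf))

end Analysis

/-- Coordinate space for forms of degree `n`. -/
abbrev V (n : ℕ) := Fin ((n + 2).choose 2) → ℝ

/-- Coordinates on forms of degree `n`. -/
def ee (n : ℕ) : H n ≃ₗ[ℝ] V n := (Module.finBasisOfFinrankEq ℝ (H n) (finrank_H n)).equivFun

/-- The form with given coordinates. -/
def po {n : ℕ} (u : V n) : S := ((ee n).symm u : H n)

theorem po_hom {n : ℕ} (u : V n) : (po u).IsHomogeneous n := ((ee n).symm u).2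

theorem po_inj {n : ℕ} {u v : V n} (h : po u = po v) : u = v :=
  (ee n).symm.injective (Subtype.ext h)

theorem po_ee {n : ℕ} (p : H n) : po (ee n p) = p := by simp [po]

theorem po_add {n : ℕ} (u v : V n) : po (u + v) = po u + po v := by simp [po]

theorem po_zero {n : ℕ} : po (0 : V n) = 0 := by simp [po]

theorem po_sum {n : ℕ} {ι : Type*} (t : Finset ι) (u : ι → V n) : po (∑ i ∈ t, u i) = ∑ i ∈ t, po (u i) := by
  simp [po]

theorem po_smul {n : ℕ} (c : ℝ) (v : V n) : po (c • v) = C c * po v := by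
  simp [po, smul_eq_C_mul]

/-- Multiplication as a continuous bilinear map. -/
def mc {a b : ℕ} (c : ℕ) (h : a + b = c) : V a →L[ℝ] V b →L[ℝ] V c :=
  LinearMap.toContinuousLinearMap ((LinearMap.toContinuousLinearMap : (V b →ₗ[ℝ] V c) ≃ₗ[ℝ] _).toLinearMap ∘ₗ
    (LinearMap.mk₂ ℝ (fun (p : V a) (q : V b) => ee c (⟨po p * po q, h ▸ (po_hom p).mul (po_hom q)⟩ : H c))
    (fun _ _ _ => po_inj (by simp only [po_ee, po_add]; ring))
    (fun _ _ _ => po_inj (by simp only [po_ee, po_smul]; ring))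
    (fun _ _ _ => po_inj (by simp only [po_ee, po_add]; ring))
    (fun _ _ _ => po_inj (by simp only [po_ee, po_smul]; ring))))

theorem mc_coe {a b c : ℕ} (h : a + b = c) (p : V a) (q : V b) : po (mc c h p q) = po p * po q := by
  simp [mc, po_ee]

/-- Product of two cubics, as a continuous bilinear map. -/
abbrev Bc : V 3 →L[ℝ] V 3 →L[ℝ] V 6 := mc 6 rfl

/-- A variable as a linear form. -/
def xx (i : Fin 3) : V 1 := ee 1 ⟨X i, isHomogeneous_X ℝ i⟩

theorem xx_coe (i : Fin 3) : po (xx i) = X i := po_ee _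

section param
variable (s : Equiv.Perm (Fin 3))

/-- The linear form cutting out the line through a conjugate pair of points. -/
def ll (w : Fin 11 → ℝ) : V 1 := xx (s 0) + w 0 • xx (s 1) + w 1 • xx (s 2)

def yy : V 2 := mc 2 (by norm_num) (xx (s 1)) (xx (s 1))
def yz : V 2 := mc 2 (by norm_num) (xx (s 1)) (xx (s 2))
def zz : V 2 := mc 2 (by norm_num) (xx (s 2)) (xx (s 2))

def qq (w : Fin 11 → ℝ) : V 2 := yy s + w 2 • yz s + w 3 • zz s

def b3 (w : Fin 11 → ℝ) : V 3 := w 4 • mc 3 (by norm_num) (xx (s 1)) (yy s) + w 5 • mc 3 (by norm_num) (xx (s 2)) (yy s) +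
  w 6 • mc 3 (by norm_num) (xx (s 1)) (zz s) + w 7 • mc 3 (by norm_num) (xx (s 2)) (zz s)

def c2 (w : Fin 11 → ℝ) : V 2 := w 8 • yy s + w 9 • yz s + w 10 • zz s

/-- Parametrization of sextics singular at a conjugate pair of points. -/
def Par (x : V 4 × (Fin 11 → ℝ)) : V 6 :=
  mc 6 (by norm_num) (mc 2 (by norm_num) (ll s x.2) (ll s x.2)) x.1 +
  mc 6 (by norm_num) (mc 3 (by norm_num) (ll s x.2) (qq s x.2)) (b3 s x.2) +
  mc 6 (by norm_num) (mc 4 (by norm_num) (qq s x.2) (qq s x.2)) (c2 s x.2)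

theorem Par_contDiff : ContDiff ℝ 1 (Par s) := by
  unfold Par ll qq b3 c2
  fun_prop

end param

/-- The bad set. -/
def Z : Set (V 6) := ⋃ s : Equiv.Perm (Fin 3), Set.range (Par s)

theorem Z_dense (f1 : V 6) : Dense {f : V 6 | ∃ b ∈ Z, ∃ t : ℝ, f = f1 + t • (b - f1)}ᶜ := by
  apply Dense.mono (s₁ := (⋃ s : Equiv.Perm (Fin 3), Set.range
    (fun x : (V 4 × (Fin 11 → ℝ)) × ℝ => f1 + x.2 • (Par s x.1 - f1)))ᶜ)
  · apply Set.compl_subset_compl.2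
    rintro f ⟨b, hb, t, rfl⟩
    obtain ⟨s, x, rfl⟩ := Set.mem_iUnion.1 hb
    exact Set.mem_iUnion.2 ⟨s, (x, t), rfl⟩
  · apply dense_compl_of_dimH_lt_finrank
    rw [dimH_iUnion]
    refine lt_of_le_of_lt (b := ((27 : ℕ) : ENNReal)) (iSup_le fun s => ?_) ?_
    · have hc : ContDiff ℝ 1 (fun x : (V 4 × (Fin 11 → ℝ)) × ℝ => f1 + x.2 • (Par s x.1 - f1)) := by
        have := Par_contDiff s
        fun_prop
      refine hc.dimH_range_le.trans ?_
      rw [Module.finrank_prod, Module.finrank_prod, Module.finrank_fintype_fun_eq_card]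
      simp [Nat.choose]
    · rw [Module.finrank_fintype_fun_eq_card]
      norm_num [Nat.choose]

theorem euler {n : ℕ} {p : S} (hp : p.IsHomogeneous (n + 1)) (s : Equiv.Perm (Fin 3)) :
    ∃ a b c : S, a.IsHomogeneous n ∧ b.IsHomogeneous n ∧ c.IsHomogeneous n ∧
      p = X (s 0) * a + X (s 1) * b + X (s 2) * c := by
  have h := hp.sum_X_mul_pderiv
  rw [← Equiv.sum_comp s, Fin.sum_univ_three] at h
  have hd : ∀ i, (C ((n + 1 : ℝ)⁻¹) * pderiv (s i) p).IsHomogeneous n := fun i => by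
    have := (isHomogeneous_C (Fin 3) ((n + 1 : ℝ)⁻¹)).mul (hp.pderiv (i := s i))
    simpa using this
  refine ⟨_, _, _, hd 0, hd 1, hd 2, ?_⟩
  have h2 : (C ((n + 1 : ℝ)⁻¹) : S) * C (n + 1 : ℝ) = 1 := by
    rw [← C_mul, inv_mul_cancel₀ (by positivity), C_1]
  have h3 : (n + 1) • p = C (n + 1 : ℝ) * p := by
    rw [nsmul_eq_mul]; simp
  rw [h3] at h
  linear_combination (-p) * h2 - C ((n + 1 : ℝ)⁻¹) * h

theorem aeval_smul {n : ℕ} {p : S} (hp : p.IsHomogeneous n) (c : ℂ) (P : Fin 3 → ℂ) :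
    aeval (c • P) p = c ^ n * aeval P p := by
  induction n generalizing p with
  | zero =>
    rw [← totalDegree_zero_iff_isHomogeneous, totalDegree_eq_zero_iff_eq_C] at hp
    rw [hp]
    simp
  | succ n ih =>
    obtain ⟨a, b, d, ha, hb, hd, rfl⟩ := euler hp (Equiv.refl _)
    simp only [map_add, map_mul, ih ha, ih hb, ih hd, aeval_X, Pi.smul_apply, smul_eq_mul]
    ring


theorem dec1 (s : Equiv.Perm (Fin 3)) (a b : ℝ) {p : S} (hp : p.IsHomogeneous 1) :
    ∃ α β γ : ℝ, p = C α * (X (s 0) + C a * X (s 1) + C b * X (s 2)) + C β * X (s 1) + C γ * X (s 2) := by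
  obtain ⟨p0, p1, p2, h0, h1, h2, rfl⟩ := euler hp s
  rw [← totalDegree_zero_iff_isHomogeneous, totalDegree_eq_zero_iff_eq_C] at h0 h1 h2
  rw [h0, h1, h2]
  generalize coeff 0 p0 = α; generalize coeff 0 p1 = β; generalize coeff 0 p2 = γ
  refine ⟨α, β - α * a, γ - α * b, ?_⟩
  simp only [C_sub, C_mul]
  ring

theorem hom1 (s : Equiv.Perm (Fin 3)) (a b : ℝ) :
    (X (s 0) + C a * X (s 1) + C b * X (s 2) : S).IsHomogeneous 1 :=
  ((isHomogeneous_X _ _).add ((isHomogeneous_X _ _).C_mul _)).add ((isHomogeneous_X _ _).C_mul _)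

theorem dec2 (s : Equiv.Perm (Fin 3)) (a b : ℝ) {p : S} (hp : p.IsHomogeneous 2) :
    ∃ n : S, n.IsHomogeneous 1 ∧ ∃ β γ δ : ℝ,
    p = (X (s 0) + C a * X (s 1) + C b * X (s 2)) * n + C β * X (s 1) ^ 2 +
      C γ * (X (s 1) * X (s 2)) + C δ * X (s 2) ^ 2 := by
  obtain ⟨p0, p1, p2, h0, h1, h2, rfl⟩ := euler hp s
  obtain ⟨α1, β1, γ1, e1⟩ := dec1 s a b h1
  obtain ⟨α2, β2, γ2, e2⟩ := dec1 s a b h2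
  obtain ⟨α0, β0, γ0, e0⟩ := dec1 s a b h0
  refine ⟨p0 + (C (α1 - a * α0) * X (s 1) + C (α2 - b * α0) * X (s 2)), h0.add
    (((isHomogeneous_X _ _).C_mul _).add ((isHomogeneous_X _ _).C_mul _)),
    β1 - a * β0, γ1 + β2 - a * γ0 - b * β0, γ2 - b * γ0, ?_⟩
  simp only [C_sub, C_mul, C_add]
  linear_combination X (s 1) * e1 + X (s 2) * e2 - (C a * X (s 1) + C b * X (s 2)) * e0

theorem dec3 (s : Equiv.Perm (Fin 3)) (a b : ℝ) {p : S} (hp : p.IsHomogeneous 3) :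
    ∃ n : S, n.IsHomogeneous 2 ∧ ∃ g0 g1 g2 g3 : ℝ,
    p = (X (s 0) + C a * X (s 1) + C b * X (s 2)) * n + C g0 * X (s 1) ^ 3 +
      C g1 * (X (s 1) ^ 2 * X (s 2)) + C g2 * (X (s 1) * X (s 2) ^ 2) + C g3 * X (s 2) ^ 3 := by
  obtain ⟨p0, p1, p2, h0, h1, h2, rfl⟩ := euler hp s
  obtain ⟨n1, hn1, α1, β1, γ1, e1⟩ := dec2 s a b h1
  obtain ⟨n2, hn2, α2, β2, γ2, e2⟩ := dec2 s a b h2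
  obtain ⟨n0, hn0, α0, β0, γ0, e0⟩ := dec2 s a b h0
  refine ⟨p0 + (X (s 1) * (n1 - C a * n0) + X (s 2) * (n2 - C b * n0)), h0.add
    (((isHomogeneous_X _ _).mul (hn1.sub (hn0.C_mul _))).add
      ((isHomogeneous_X _ _).mul (hn2.sub (hn0.C_mul _)))),
    α1 - a * α0, β1 + α2 - a * β0 - b * α0, γ1 + β2 - a * γ0 - b * β0, γ2 - b * γ0, ?_⟩
  simp only [C_sub, C_mul, C_add]
  linear_combination X (s 1) * e1 + X (s 2) * e2 - (C a * X (s 1) + C b * X (s 2)) * e0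

/-- Shape of the squares. -/
def Good (s : Equiv.Perm (Fin 3)) (a b c d : ℝ) (f : S) : Prop :=
  ∃ A : S, A.IsHomogeneous 4 ∧ ∃ w : Fin 7 → ℝ,
    f = (X (s 0) + C a * X (s 1) + C b * X (s 2)) ^ 2 * A +
      (X (s 0) + C a * X (s 1) + C b * X (s 2)) *
        (X (s 1) ^ 2 + C c * (X (s 1) * X (s 2)) + C d * X (s 2) ^ 2) *
        (C (w 0) * X (s 1) ^ 3 + C (w 1) * (X (s 2) * X (s 1) ^ 2) + C (w 2) * (X (s 1) * X (s 2) ^ 2) +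
          C (w 3) * X (s 2) ^ 3) +
      (X (s 1) ^ 2 + C c * (X (s 1) * X (s 2)) + C d * X (s 2) ^ 2) ^ 2 *
        (C (w 4) * X (s 1) ^ 2 + C (w 5) * (X (s 1) * X (s 2)) + C (w 6) * X (s 2) ^ 2)

theorem Good.add {s : Equiv.Perm (Fin 3)} {a b c d : ℝ} {f g : S} (hf : Good s a b c d f)
    (hg : Good s a b c d g) : Good s a b c d (f + g) := by
  obtain ⟨A, hA, w, rfl⟩ := hf
  obtain ⟨A', hA', w', rfl⟩ := hg
  refine ⟨A + A', hA.add hA', w + w', ?_⟩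
  simp only [Pi.add_apply, C_add]
  ring

theorem Good.mem_Z {s : Equiv.Perm (Fin 3)} {a b c d : ℝ} {f : V 6} (hf : Good s a b c d (po f)) :
    f ∈ Z := by
  obtain ⟨A, hA, w, h⟩ := hf
  refine Set.mem_iUnion.2 ⟨s, (ee 4 ⟨A, hA⟩, ![a, b, c, d, w 0, w 1, w 2, w 3, w 4, w 5, w 6]), ?_⟩
  apply po_inj
  rw [h]
  simp only [Par, ll, qq, b3, c2, yy, yz, zz, po_add, mc_coe, po_smul, po_ee, xx_coe]
  simp
  ring

theorem square_good {s : Equiv.Perm (Fin 3)} {a b c d : ℝ} {p : S} (hp : p.IsHomogeneous 3)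
    {P : Fin 3 → ℂ} (h2 : P (s 2) = 1) (hτ : (P (s 1)).im ≠ 0)
    (hl : P (s 0) + a * P (s 1) + b = 0) (hq : P (s 1) ^ 2 + c * P (s 1) + d = 0)
    (h0 : aeval P p = 0) : Good s a b c d (p ^ 2) := by
  obtain ⟨n, hn, g0, g1, g2, g3, rfl⟩ := dec3 s a b hp
  obtain ⟨m, hm, β0, β1, β2, rfl⟩ := dec2 s a b hn
  simp only [map_add, map_mul, map_pow, aeval_X, aeval_C, h2, Complex.coe_algebraMap, mul_one,
    one_pow, hl, zero_mul, zero_add] at h0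
  set τ := P (s 1)
  set R1 := g2 - d * g0 - c * (g1 - c * g0) with hR1
  set R0 := g3 - d * (g1 - c * g0) with hR0
  have hR : (R1 : ℂ) * τ + R0 = 0 := by
    rw [hR1, hR0]; push_cast
    linear_combination h0 - (g0 * τ + g1 - c * g0) * hq
  have h1 : R1 = 0 := by
    have := congrArg Complex.im hR
    simp at this
    exact this.resolve_right hτ
  have h00 : R0 = 0 := by
    rw [h1] at hR
    simpa using hR
  have e2 : g2 = d * g0 + c * (g1 - c * g0) := by linarith
  have e3 : g3 = d * (g1 - c * g0) := by linarith
  set m1 := g1 - c * g0 with hm1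
  have eg : g1 = m1 + c * g0 := by rw [hm1]; ring
  set y : S := X (s 1)
  set z : S := X (s 2)
  have hy : y.IsHomogeneous 1 := isHomogeneous_X _ _
  have hz : z.IsHomogeneous 1 := isHomogeneous_X _ _
  have hL := hom1 s a b
  set l : S := X (s 0) + C a * y + C b * z
  have hb : (C β0 * y ^ 2 + C β1 * (y * z) + C β2 * z ^ 2).IsHomogeneous 2 :=
    (((hy.pow 2).C_mul _).add ((hy.mul hz).C_mul _)).add ((hz.pow 2).C_mul _)
  have hqq : (y ^ 2 + C c * (y * z) + C d * z ^ 2).IsHomogeneous 2 :=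
    ((hy.pow 2).add ((hy.mul hz).C_mul _)).add ((hz.pow 2).C_mul _)
  have hmm : (C g0 * y + C m1 * z).IsHomogeneous 1 := (hy.C_mul _).add (hz.C_mul _)
  refine ⟨(l * m + (C β0 * y ^ 2 + C β1 * (y * z) + C β2 * z ^ 2)) ^ 2 +
      C 2 * ((y ^ 2 + C c * (y * z) + C d * z ^ 2) * m * (C g0 * y + C m1 * z)),
    (((hL.mul hm).add hb).pow 2).add (((hqq.mul hm).mul hmm).C_mul _),
    ![2 * β0 * g0, 2 * (β0 * m1 + β1 * g0), 2 * (β1 * m1 + β2 * g0), 2 * β2 * m1,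
      g0 ^ 2, 2 * g0 * m1, m1 ^ 2], ?_⟩
  have ec : (C 2 : S) = 2 := map_ofNat C 2
  simp only [e2, e3, eg, Matrix.cons_val, C_mul, C_add, C_pow, ec]
  ring

theorem SQ_po (p : Fin 4 → V 3) : po (SQ Bc p) = ∑ i, po (p i) ^ 2 := by
  simp only [SQ, po_sum, mc_coe, sq]

/-- evaluation at a real point -/
def evL (v : Fin 3 → ℝ) : V 6 →L[ℝ] ℝ := LinearMap.toContinuousLinearMap
  { toFun := fun f => eval v (po f)
    map_add' := fun f g => by simp [po_add]
    map_smul' := fun c f => by simp [po_smul] }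

theorem evL_apply (v : Fin 3 → ℝ) (f : V 6) : evL v f = eval v (po f) := rfl

theorem no_zero {p : Fin 4 → V 3} (hZ : SQ Bc p ∉ Z)
    (hL : ∀ L : V 6 →L[ℝ] ℝ, L ≠ 0 → (∀ q, 0 ≤ L (Bc q q)) → L (SQ Bc p) ≠ 0)
    {P : Fin 3 → ℂ} (hP : ∀ i, aeval P (po (p i)) = 0) : P = 0 := by
  by_contra hne
  obtain ⟨j, hj⟩ : ∃ j, P j ≠ 0 := by
    by_contra! h; exact hne (funext h)
  set Q : Fin 3 → ℂ := (P j)⁻¹ • P with hQ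
  have hQj : Q j = 1 := by simp [hQ, hj]
  have hQ0 : ∀ i, aeval Q (po (p i)) = 0 := fun i => by
    rw [hQ, aeval_smul (po_hom (p i)), hP, mul_zero]
  by_cases him : ∃ k, (Q k).im ≠ 0
  · obtain ⟨k, hk⟩ := him
    have hkj : k ≠ j := by rintro rfl; simp [hQj] at hk
    obtain ⟨s, hs1, hs2⟩ : ∃ s : Equiv.Perm (Fin 3), s 1 = k ∧ s 2 = j := by
      clear_value Q
      revert hkj
      clear hk hQj hQ hj
      revert j k
      decide
    set a := - (Q (s 0)).im / (Q k).im with ha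
    set b := - (Q (s 0)).re - a * (Q k).re with hb
    have hG : ∀ i, Good s a b (- 2 * (Q k).re) ((Q k).re ^ 2 + (Q k).im ^ 2) (po (p i) ^ 2) := by
      intro i
      refine square_good (po_hom _) (P := Q) (by rw [hs2, hQj]) (by rwa [hs1]) ?_ ?_ (hQ0 i)
      · rw [hs1]
        apply Complex.ext
        · simp [hb]
        · simp [ha]
          field_simp
          ring
      · rw [hs1]
        apply Complex.ext
        · simp [sq]; ring
        · simp [sq]; ring
    apply hZ
    apply Good.mem_Z (s := s) (a := a) (b := b)
    rw [SQ_po, Fin.sum_univ_four]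
    exact (((hG 0).add (hG 1)).add (hG 2)).add (hG 3)
  · push Not at him
    set v : Fin 3 → ℝ := fun i => (Q i).re with hv
    have hQv : Q = fun i => ((v i : ℝ) : ℂ) := by
      funext i
      apply Complex.ext <;> simp [hv, him]
    have hev : ∀ i, eval v (po (p i)) = 0 := by
      intro i
      have h := hQ0 i
      have h2 : aeval Q (po (p i)) = ((eval v (po (p i)) : ℝ) : ℂ) := by
        rw [hQv, ← coe_aeval_eq_eval, RingHom.coe_coe]
        exact aeval_algebraMap_apply ℂ v (po (p i))
      rw [h2] at h
      exact_mod_cast h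
    refine hL (evL v) ?_ ?_ ?_
    · intro h
      have h6 : ((X j : S) ^ 6).IsHomogeneous 6 := isHomogeneous_X_pow j 6
      have := DFunLike.congr_fun h (ee 6 ⟨_, h6⟩)
      rw [evL_apply, po_ee] at this
      simp [hv, hQj] at this
    · intro q
      rw [evL_apply, mc_coe, map_mul]
      exact mul_self_nonneg _
    · rw [evL_apply, SQ_po]
      simp [hev]

theorem noZero_of {p : Fin 4 → H 3}
    (h : ∀ P : Fin 3 → ℂ, (∀ i, aeval P (p i : S) = 0) → P = 0) : NoZero p := by
  intro P hP hp j
  rw [← MvPolynomial.IsPrime.vanishingIdeal_zeroLocus (K := ℂ) P, mem_vanishingIdeal_iff]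
  intro x hx
  have := h x fun i => (mem_zeroLocus_iff.1 hx) _ (hp i)
  simp [this]

theorem D_po (p q : Fin 4 → V 3) :
    ((D (fun i => (ee 3).symm (p i)) (fun i => (ee 3).symm (q i)) : H 6) : S) =
      po (∑ i, Bc (p i) (q i)) := by
  rw [D_apply, po_sum]
  simp only [mc_coe]
  simp [po, B_coe]

theorem surj_of {p : Fin 4 → V 3} (h : LinearMap.range (D (fun i => (ee 3).symm (p i))) = ⊤) (f : V 6) :
    ∃ q : Fin 4 → V 3, ∑ i, Bc (p i) (q i) = f := by
  obtain ⟨q, hq⟩ := LinearMap.range_eq_top.1 h ((ee 6).symm f)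
  refine ⟨fun i => ee 3 (q i), ?_⟩
  apply po_inj
  rw [← D_po]
  simp [hq, po]

theorem key {p : Fin 4 → V 3} (hZ : SQ Bc p ∉ Z)
    (hL : ∀ L : V 6 →L[ℝ] ℝ, L ≠ 0 → (∀ q, 0 ≤ L (Bc q q)) → L (SQ Bc p) ≠ 0) :
      (∀ f, ∃ q : Fin 4 → V 3, ∑ i, Bc (p i) (q i) = f) ∨
      ∃ c : Fin 4 → ℝ, ∑ i, c i ^ 2 = 1 ∧ ∑ i, c i • p i = 0 ∧ ∃ L : V 6 →L[ℝ] ℝ, L ≠ 0 ∧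
        (∀ q : Fin 4 → V 3, L (∑ i, Bc (p i) (q i)) = 0) ∧
        (∀ f, L f = 0 → ∃ q : Fin 4 → V 3, ∑ i, Bc (p i) (q i) = f) := by
  have hN : NoZero (fun i => (ee 3).symm (p i)) := noZero_of fun P hP => no_zero hZ hL hP
  by_cases htop : LinearMap.range (D (fun i => (ee 3).symm (p i))) = ⊤
  · exact Or.inl (surj_of htop)
  right
  have hld : ¬ LinearIndependent ℝ p := by
    intro hli
    refine htop (alg2 hN ?_)
    exact hli.map' (ee 3).symm.toLinearMap (LinearEquiv.ker _)
  obtain ⟨c, hc, i, hi⟩ := Fintype.not_linearIndependent_iff.1 hld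
  have hpos : 0 < ∑ i, c i ^ 2 :=
    Finset.sum_pos' (fun i _ => sq_nonneg _) ⟨i, Finset.mem_univ _, by positivity⟩
  have hr := alg1 hN
  refine ⟨fun i => (Real.sqrt (∑ i, c i ^ 2))⁻¹ * c i, ?_, ?_, ?_⟩
  · simp only [mul_pow, ← Finset.mul_sum, inv_pow, Real.sq_sqrt hpos.le]
    exact inv_mul_cancel₀ hpos.ne'
  · simp only [mul_smul, ← Finset.smul_sum, hc, smul_zero]
  set W := LinearMap.range (D (fun i => (ee 3).symm (p i))) with hW
  obtain ⟨l, hl, hlW⟩ := Submodule.exists_le_ker_of_lt_top W (lt_top_iff_ne_top.2 htop)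
  have hker : W = LinearMap.ker l := by
    apply Submodule.eq_of_le_of_finrank_le hlW
    have h1 := Submodule.finrank_lt (s := LinearMap.ker l) (by
      intro h; exact hl (LinearMap.ker_eq_top.1 h))
    rw [finrank_H] at h1
    norm_num [Nat.choose] at h1
    omega
  refine ⟨LinearMap.toContinuousLinearMap (l ∘ₗ (ee 6).symm.toLinearMap), ?_, ?_, ?_⟩
  · intro h
    apply hl
    ext1 f
    have := DFunLike.congr_fun h (ee 6 f)
    simpa using this
  · intro q
    have : D (fun i => (ee 3).symm (p i)) (fun i => (ee 3).symm (q i)) ∈ LinearMap.ker l := by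
      rw [← hker]; exact ⟨_, rfl⟩
    have e : (ee 6).symm (∑ i, Bc (p i) (q i)) =
        D (fun i => (ee 3).symm (p i)) (fun i => (ee 3).symm (q i)) :=
      Subtype.ext (D_po p q).symm
    simpa [← e] using this
  · intro f hf
    have : (ee 6).symm f ∈ W := by
      rw [hker]; simpa using hf
    obtain ⟨q, hq⟩ := this
    refine ⟨fun i => ee 3 (q i), ?_⟩
    apply po_inj
    rw [← D_po]
    simp [hq, po]

theorem hdef (p : Fin 4 → V 3) (h : SQ Bc p = 0) : p = 0 := by
  have h1 := SQ_po p
  rw [h, po_zero] at h1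
  funext i
  apply po_inj
  rw [Pi.zero_apply, po_zero]
  apply MvPolynomial.funext
  intro v
  have h2 := congrArg (eval v) h1
  simp only [map_zero, map_sum, map_pow] at h2 ⊢
  have h3 := (Finset.sum_eq_zero_iff_of_nonneg (fun i _ => sq_nonneg _)).1 h2.symm i (Finset.mem_univ _)
  exact pow_eq_zero_iff (two_ne_zero) |>.1 h3

theorem hne : ∃ p : Fin 4 → V 3, ∀ f, ∃ q : Fin 4 → V 3, ∑ i, Bc (p i) (q i) = f := by
  have X1 := fun j => isHomogeneous_X ℝ (j : Fin 3)
  set p : Fin 4 → H 3 := ![⟨X 0 ^ 3, (X1 0).pow 3⟩, ⟨X 1 ^ 3, (X1 1).pow 3⟩, ⟨X 2 ^ 3, (X1 2).pow 3⟩,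
    ⟨X 0 * X 1 * X 2, ((X1 0).mul (X1 1)).mul (X1 2)⟩] with hp
  have hN : NoZero p := by
    intro P hP h j
    have h0 := hP.mem_of_pow_mem 3 (h 0)
    have h1 := hP.mem_of_pow_mem 3 (h 1)
    have h2 := hP.mem_of_pow_mem 3 (h 2)
    fin_cases j
    · exact h0
    · exact h1
    · exact h2
  have hli : LinearIndependent ℝ p := by
    rw [Fintype.linearIndependent_iff]
    intro c hc
    have hc' := congrArg (Subtype.val : H 3 → S) hc
    simp only [hp, Fin.sum_univ_four, Submodule.coe_add, Submodule.coe_smul, Matrix.cons_val,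
      smul_eq_C_mul, Submodule.coe_zero] at hc'
    have h0 := congrArg (eval ![1, 0, 0]) hc'
    have h1 := congrArg (eval ![0, 1, 0]) hc'
    have h2 := congrArg (eval ![0, 0, 1]) hc'
    have h3 := congrArg (eval ![1, 1, 1]) hc'
    simp at h0 h1 h2 h3
    intro i
    fin_cases i
    · exact h0
    · exact h1
    · exact h2
    · simpa [h0, h1, h2] using h3
  refine ⟨fun i => ee 3 (p i), fun f => surj_of ?_ f⟩
  simp only [LinearEquiv.symm_apply_apply]
  exact alg2 hN hli

theorem upper (f : MvPolynomial (Fin 3) ℝ) (hf : InSigma 3 3 f) : IsSOS 3 3 4 f := by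
  obtain ⟨r, q, hq, rfl⟩ := hf
  have hmain := main_analysis (B := Bc) (fun p q => po_inj (by rw [mc_coe, mc_coe, mul_comm]))
    hdef Z Z_dense hne (fun p h1 h2 => key h1 h2)
  obtain ⟨p, hp⟩ := hmain (show ∑ i, Bc (ee 3 ⟨q i, hq i⟩) (ee 3 ⟨q i, hq i⟩) ∈ Sig Bc from
    AddSubmonoid.sum_mem (AddSubmonoid.closure (Set.range fun q => Bc q q)) fun i _ =>
      AddSubmonoid.subset_closure (Set.mem_range_self (ee 3 ⟨q i, hq i⟩)))
  refine ⟨fun i => po (p i), fun i => po_hom _, ?_⟩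
  rw [← SQ_po, hp, po_sum]
  refine Finset.sum_congr rfl fun i _ => ?_
  rw [mc_coe, po_ee, sq]

theorem expl {p : S} (hp : p.IsHomogeneous 3) : ∃ a : Fin 10 → ℝ, ∀ x y : ℝ,
    eval ![x, y, 1] p = a 0 * (x ^ 3) + a 1 * (x ^ 2 * y) + a 2 * (x * y ^ 2) + a 3 * (y ^ 3) + a 4 * (x ^ 2) + a 5 * (x * y) + a 6 * (y ^ 2) + a 7 * (x) + a 8 * (y) + a 9 := by
  obtain ⟨n, hn, g0, g1, g2, g3, rfl⟩ := dec3 (Equiv.refl _) 0 0 hp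
  obtain ⟨m, hm, b0, b1, b2, rfl⟩ := dec2 (Equiv.refl _) 0 0 hn
  obtain ⟨e0, e1, e2, rfl⟩ := dec1 (Equiv.refl _) 0 0 hm
  refine ⟨![e0, e1, b0, g0, e2, b1, g1, b2, g2, g3], fun x y => ?_⟩
  simp [Matrix.cons_val]
  ring

theorem poly6 {c0 c1 c2 c3 c4 c5 c6 : ℝ} (h : ∀ t : ℝ, c0 + c1 * t + c2 * t ^ 2 + c3 * t ^ 3 +
    c4 * t ^ 4 + c5 * t ^ 5 + c6 * t ^ 6 = 0) :
    c0 = 0 ∧ c1 = 0 ∧ c2 = 0 ∧ c3 = 0 ∧ c4 = 0 ∧ c5 = 0 ∧ c6 = 0 := by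
  have h0 := h 0
  have h1 := h 1
  have h2 := h (-1)
  have h3 := h 2
  have h4 := h (-2)
  have h5 := h 3
  have h6 := h (-3)
  norm_num at h0 h1 h2 h3 h4 h5 h6
  refine ⟨?_, ?_, ?_, ?_, ?_, ?_, ?_⟩ <;> linarith

/-- The example of length four. -/
def ex : MvPolynomial (Fin 3) ℝ := (X 0 ^ 2 * X 1) ^ 2 + (X 0 * X 1 ^ 2) ^ 2 + (X 2 ^ 3) ^ 2 +
  (X 0 * X 1 * X 2) ^ 2

theorem gram_sq {a : Fin 3 → Fin 10 → ℝ} {k : Fin 10} (h : ∑ i, a i k * a i k = 0) (i : Fin 3) :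
    a i k = 0 := by
  have := (Finset.sum_eq_zero_iff_of_nonneg (fun i _ => mul_self_nonneg _)).1 h i (Finset.mem_univ _)
  exact mul_self_eq_zero.1 this

theorem lower : ¬ IsSOS 3 3 3 ex := by
  rintro ⟨p, hp, h⟩
  choose a ha using fun i => expl (hp i)
  set g : Fin 10 → Fin 10 → ℝ := fun k l => ∑ i, a i k * a i l with hg
  have hxy : ∀ x y : ℝ,
      ((g 9 9 - 1) +
        (2 * g 7 9) * x +
        (2 * g 4 9 + g 7 7) * x ^ 2 +
        (2 * g 0 9 + 2 * g 4 7) * x ^ 3 +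
        (2 * g 0 7 + g 4 4) * x ^ 4 +
        (2 * g 0 4) * x ^ 5 +
        (g 0 0) * x ^ 6) +
      ((2 * g 8 9) +
        (2 * g 5 9 + 2 * g 7 8) * x +
        (2 * g 1 9 + 2 * g 4 8 + 2 * g 5 7) * x ^ 2 +
        (2 * g 0 8 + 2 * g 1 7 + 2 * g 4 5) * x ^ 3 +
        (2 * g 0 5 + 2 * g 1 4) * x ^ 4 +
        (2 * g 0 1) * x ^ 5 +
        0 * x ^ 6) * y +
      ((2 * g 6 9 + g 8 8) +
        (2 * g 2 9 + 2 * g 5 8 + 2 * g 6 7) * x +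
        (2 * g 1 8 + 2 * g 2 7 + 2 * g 4 6 + g 5 5 - 1) * x ^ 2 +
        (2 * g 0 6 + 2 * g 1 5 + 2 * g 2 4) * x ^ 3 +
        (2 * g 0 2 + g 1 1 - 1) * x ^ 4 +
        0 * x ^ 5 +
        0 * x ^ 6) * y ^ 2 +
      ((2 * g 3 9 + 2 * g 6 8) +
        (2 * g 2 8 + 2 * g 3 7 + 2 * g 5 6) * x +
        (2 * g 1 6 + 2 * g 2 5 + 2 * g 3 4) * x ^ 2 +
        (2 * g 0 3 + 2 * g 1 2) * x ^ 3 +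
        0 * x ^ 4 +
        0 * x ^ 5 +
        0 * x ^ 6) * y ^ 3 +
      ((2 * g 3 8 + g 6 6) +
        (2 * g 2 6 + 2 * g 3 5) * x +
        (2 * g 1 3 + g 2 2 - 1) * x ^ 2 +
        0 * x ^ 3 +
        0 * x ^ 4 +
        0 * x ^ 5 +
        0 * x ^ 6) * y ^ 4 +
      ((2 * g 3 6) +
        (2 * g 2 3) * x +
        0 * x ^ 2 +
        0 * x ^ 3 +
        0 * x ^ 4 +
        0 * x ^ 5 +
        0 * x ^ 6) * y ^ 5 +
      ((g 3 3) +
        0 * x +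
        0 * x ^ 2 +
        0 * x ^ 3 +
        0 * x ^ 4 +
        0 * x ^ 5 +
        0 * x ^ 6) * y ^ 6 = 0 := by
    intro x y
    have h1 := congrArg (eval ![x, y, 1]) h
    simp only [ex, map_add, map_mul, map_pow, map_sum, eval_X, ha, Matrix.cons_val,
      Fin.sum_univ_three] at h1
    simp only [hg, Fin.sum_univ_three]
    linear_combination -h1
  have hx0 := fun x => (poly6 (hxy x)).1
  have hx1 := fun x => (poly6 (hxy x)).2.1
  have hx2 := fun x => (poly6 (hxy x)).2.2.1
  have hx3 := fun x => (poly6 (hxy x)).2.2.2.1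
  have hx4 := fun x => (poly6 (hxy x)).2.2.2.2.1
  have hx5 := fun x => (poly6 (hxy x)).2.2.2.2.2.1
  have hx6 := fun x => (poly6 (hxy x)).2.2.2.2.2.2
  obtain ⟨e00, e10, e20, e30, e40, e50, e60⟩ := poly6 hx0
  obtain ⟨e01, e11, e21, e31, e41, e51, e61⟩ := poly6 hx1
  obtain ⟨e02, e12, e22, e32, e42, e52, e62⟩ := poly6 hx2
  obtain ⟨e03, e13, e23, e33, e43, e53, e63⟩ := poly6 hx3
  obtain ⟨e04, e14, e24, e34, e44, e54, e64⟩ := poly6 hx4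
  obtain ⟨e05, e15, e25, e35, e45, e55, e65⟩ := poly6 hx5
  obtain ⟨e06, e16, e26, e36, e46, e56, e66⟩ := poly6 hx6
  clear hxy hx0 hx1 hx2 hx3 hx4 hx5 hx6
  have gz : ∀ k, g k k = 0 → (∀ l, g k l = 0) ∧ ∀ l, g l k = 0 := by
    intro k hk
    have := gram_sq (a := a) hk
    simp [hg, this]
  obtain ⟨z0, z0'⟩ := gz 0 e60
  obtain ⟨z3, z3'⟩ := gz 3 e06
  simp only [z0, z0', z3, z3', mul_zero, zero_add, add_zero] at *
  obtain ⟨z4, z4'⟩ := gz 4 (by linarith)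
  obtain ⟨z6, z6'⟩ := gz 6 (by linarith)
  simp only [z4, z4', z6, z6', mul_zero, zero_add, add_zero] at *
  obtain ⟨z7, z7'⟩ := gz 7 (by linarith)
  obtain ⟨z8, z8'⟩ := gz 8 (by linarith)
  simp only [z7, z7', z8, z8', mul_zero, zero_add, add_zero] at *
  have hsymm : ∀ k l, g k l = g l k := fun k l => by simp only [hg, mul_comm]
  set M : Matrix (Fin 4) (Fin 3) ℝ := fun j i => a i (![1, 2, 9, 5] j) with hM
  have hMM : M * M.transpose = 1 := by
    ext j j'
    have : (M * M.transpose) j j' = g (![1, 2, 9, 5] j) (![1, 2, 9, 5] j') := by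
      rw [Matrix.mul_apply]; rfl
    rw [this]
    fin_cases j <;> fin_cases j' <;> simp <;>
      linarith [hsymm 1 2, hsymm 1 9, hsymm 1 5, hsymm 2 9, hsymm 2 5, hsymm 9 5]
  have r1 := Matrix.rank_mul_le_left M M.transpose
  rw [hMM, Matrix.rank_one] at r1
  have r2 := Matrix.rank_le_width M
  simp at r1
  omega

theorem ex_mem : InSigma 3 3 ex := by
  have X1 := fun j => isHomogeneous_X ℝ (j : Fin 3)
  refine ⟨4, ![X 0 ^ 2 * X 1, X 0 * X 1 ^ 2, X 2 ^ 3, X 0 * X 1 * X 2], ?_, ?_⟩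
  · intro i
    fin_cases i
    · exact ((X1 0).pow 2).mul (X1 1)
    · exact (X1 0).mul ((X1 1).pow 2)
    · exact (X1 2).pow 3
    · exact ((X1 0).mul (X1 1)).mul (X1 2)
  · simp [ex, Fin.sum_univ_four]

end TS

/-- `p(3,6) = 4`: every ternary sextic that is a sum of squares of cubic forms
is a sum of four squares of cubic forms, and some such sextic is not a sum of
three squares of cubic forms. -/
theorem p_three_six :
    (∀ f : MvPolynomial (Fin 3) ℝ, InSigma 3 3 f → IsSOS 3 3 4 f) ∧
    (∃ f : MvPolynomial (Fin 3) ℝ, InSigma 3 3 f ∧ ¬ IsSOS 3 3 3 f) := by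
  exact ⟨TS.upper, TS.ex, TS.ex_mem, TS.lower⟩
end
end
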